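/- arXiv:2109.06423 — 3 statements merged into one kernel-verified Lean document; each statement's English description precedes it below -/
import Mathlib

section
/- Let a < b be real numbers and n, p, m ∈ ℕ. Let N = (N0, N1, N2) be a family of 1D-PI kernels of size n×p on [a,b] and M = (M0, M1, M2) a family of 1D-PI kernels of size p×m on [a,b]. Define Q0(x) = N0(x)M0(x); Q1(x,θ) = N0(x)M1(x,θ) + N1(x,θ)M0(θ) + ∫_θ^x N1(x,η)M1(η,θ)dη + ∫_a^θ N1(x,η)M2(η,θ)dη + ∫_x^b N2(x,η)M1(η,θ)dη; and Q2(x,θ) = N0(x)M2(x,θ) + N2(x,θ)M0(θ) + ∫_x^θ N2(x,η)M2(η,θ)dη + ∫_a^x N1(x,η)M2(η,θ)dη + ∫_θ^b N2(x,η)M1(η,θ)dη. Then Q = (Q0, Q1, Q2) is a family of 1D-PI kernels of size n×m on [a,b], and for every continuous u : [a,b] → ℝ^m and every x ∈ [a,b], (P[N](P[M]u))(x) = (P[Q]u)(x). -/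
open Matrix MeasureTheory Set

noncomputable section

/-- A family of 1D-PI kernels of size `p × r` (the parameters of a 1D-PI operator). -/
structure PI1DK (p r : ℕ) where
  k0 : ℝ → Matrix (Fin p) (Fin r) ℝ
  k1 : ℝ → ℝ → Matrix (Fin p) (Fin r) ℝ
  k2 : ℝ → ℝ → Matrix (Fin p) (Fin r) ℝ

/-- Continuity of a family of 1D-PI kernels on the interval `[s,t]`. -/
def PI1DK.IsCont {p r : ℕ} (s t : ℝ) (N : PI1DK p r) : Prop :=
  ContinuousOn N.k0 (Icc s t) ∧
  ContinuousOn (fun q : ℝ × ℝ => N.k1 q.1 q.2) (Icc s t ×ˢ Icc s t) ∧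
  ContinuousOn (fun q : ℝ × ℝ => N.k2 q.1 q.2) (Icc s t ×ˢ Icc s t)

/-- The 1D-PI operator on `[s,t]` associated with the kernels `N`. -/
def PI1D {p r : ℕ} (s t : ℝ) (N : PI1DK p r) (u : ℝ → Fin r → ℝ) (x : ℝ) :
    Fin p → ℝ :=
  N.k0 x *ᵥ u x + (∫ θ in s..x, N.k1 x θ *ᵥ u θ) + (∫ θ in x..t, N.k2 x θ *ᵥ u θ)

/-- Entrywise interval integral of a matrix-valued function. -/
def mInt {p r : ℕ} (s t : ℝ) (F : ℝ → Matrix (Fin p) (Fin r) ℝ) :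
    Matrix (Fin p) (Fin r) ℝ :=
  Matrix.of fun i j => ∫ η in s..t, F η i j

/-- A family of 2D-PI kernels of size `p × r`. -/
structure PI2DK (p r : ℕ) where
  k00 : ℝ → ℝ → Matrix (Fin p) (Fin r) ℝ
  k10 : ℝ → ℝ → ℝ → Matrix (Fin p) (Fin r) ℝ
  k20 : ℝ → ℝ → ℝ → Matrix (Fin p) (Fin r) ℝ
  k01 : ℝ → ℝ → ℝ → Matrix (Fin p) (Fin r) ℝ
  k02 : ℝ → ℝ → ℝ → Matrix (Fin p) (Fin r) ℝ
  k11 : ℝ → ℝ → ℝ → ℝ → Matrix (Fin p) (Fin r) ℝ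
  k21 : ℝ → ℝ → ℝ → ℝ → Matrix (Fin p) (Fin r) ℝ
  k12 : ℝ → ℝ → ℝ → ℝ → Matrix (Fin p) (Fin r) ℝ
  k22 : ℝ → ℝ → ℝ → ℝ → Matrix (Fin p) (Fin r) ℝ

/-- Continuity of a family of 2D-PI kernels on `[a,b] × [c,d]`. -/
def PI2DK.IsCont {p r : ℕ} (a b c d : ℝ) (N : PI2DK p r) : Prop :=
  ContinuousOn (fun q : ℝ × ℝ => N.k00 q.1 q.2) (Icc a b ×ˢ Icc c d) ∧
  ContinuousOn (fun q : ℝ × ℝ × ℝ => N.k10 q.1 q.2.1 q.2.2)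
    (Icc a b ×ˢ Icc c d ×ˢ Icc a b) ∧
  ContinuousOn (fun q : ℝ × ℝ × ℝ => N.k20 q.1 q.2.1 q.2.2)
    (Icc a b ×ˢ Icc c d ×ˢ Icc a b) ∧
  ContinuousOn (fun q : ℝ × ℝ × ℝ => N.k01 q.1 q.2.1 q.2.2)
    (Icc a b ×ˢ Icc c d ×ˢ Icc c d) ∧
  ContinuousOn (fun q : ℝ × ℝ × ℝ => N.k02 q.1 q.2.1 q.2.2)
    (Icc a b ×ˢ Icc c d ×ˢ Icc c d) ∧
  ContinuousOn (fun q : ℝ × ℝ × ℝ × ℝ => N.k11 q.1 q.2.1 q.2.2.1 q.2.2.2)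
    (Icc a b ×ˢ Icc c d ×ˢ Icc a b ×ˢ Icc c d) ∧
  ContinuousOn (fun q : ℝ × ℝ × ℝ × ℝ => N.k21 q.1 q.2.1 q.2.2.1 q.2.2.2)
    (Icc a b ×ˢ Icc c d ×ˢ Icc a b ×ˢ Icc c d) ∧
  ContinuousOn (fun q : ℝ × ℝ × ℝ × ℝ => N.k12 q.1 q.2.1 q.2.2.1 q.2.2.2)
    (Icc a b ×ˢ Icc c d ×ˢ Icc a b ×ˢ Icc c d) ∧
  ContinuousOn (fun q : ℝ × ℝ × ℝ × ℝ => N.k22 q.1 q.2.1 q.2.2.1 q.2.2.2)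
    (Icc a b ×ˢ Icc c d ×ˢ Icc a b ×ˢ Icc c d)

/-- The 2D-PI operator on `[a,b] × [c,d]` associated with the kernels `N`. -/
def PI2D {p r : ℕ} (a b c d : ℝ) (N : PI2DK p r) (u : ℝ → ℝ → Fin r → ℝ)
    (x y : ℝ) : Fin p → ℝ :=
  N.k00 x y *ᵥ u x y
  + (∫ θ in a..x, N.k10 x y θ *ᵥ u θ y)
  + (∫ θ in x..b, N.k20 x y θ *ᵥ u θ y)
  + (∫ ν in c..y, N.k01 x y ν *ᵥ u x ν)
  + (∫ ν in y..d, N.k02 x y ν *ᵥ u x ν)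
  + (∫ θ in a..x, ∫ ν in c..y, N.k11 x y θ ν *ᵥ u θ ν)
  + (∫ θ in x..b, ∫ ν in c..y, N.k21 x y θ ν *ᵥ u θ ν)
  + (∫ θ in a..x, ∫ ν in y..d, N.k12 x y θ ν *ᵥ u θ ν)
  + (∫ θ in x..b, ∫ ν in y..d, N.k22 x y θ ν *ᵥ u θ ν)

/-- A family of 011-PI kernels of size `(p0,p1) × (r0,r1)`. -/
structure PI011K (p0 p1 r0 r1 : ℕ) where
  b00 : Matrix (Fin p0) (Fin r0) ℝ
  b01 : ℝ → Matrix (Fin p0) (Fin r1) ℝ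
  b02 : ℝ → Matrix (Fin p0) (Fin r1) ℝ
  b10 : ℝ → Matrix (Fin p1) (Fin r0) ℝ
  b20 : ℝ → Matrix (Fin p1) (Fin r0) ℝ
  b12 : ℝ → ℝ → Matrix (Fin p1) (Fin r1) ℝ
  b21 : ℝ → ℝ → Matrix (Fin p1) (Fin r1) ℝ
  b11 : PI1DK p1 r1
  b22 : PI1DK p1 r1

/-- Continuity of a family of 011-PI kernels. -/
def PI011K.IsCont {p0 p1 r0 r1 : ℕ} (a b c d : ℝ) (B : PI011K p0 p1 r0 r1) : Prop :=
  ContinuousOn B.b01 (Icc a b) ∧ ContinuousOn B.b02 (Icc c d) ∧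
  ContinuousOn B.b10 (Icc a b) ∧ ContinuousOn B.b20 (Icc c d) ∧
  ContinuousOn (fun q : ℝ × ℝ => B.b12 q.1 q.2) (Icc a b ×ˢ Icc c d) ∧
  ContinuousOn (fun q : ℝ × ℝ => B.b21 q.1 q.2) (Icc c d ×ˢ Icc a b) ∧
  B.b11.IsCont a b ∧ B.b22.IsCont c d

/-- The 011-PI operator associated with the kernels `B`. -/
def PI011 {p0 p1 r0 r1 : ℕ} (a b c d : ℝ) (B : PI011K p0 p1 r0 r1)
    (v : Fin r0 → ℝ) (u1 u2 : ℝ → Fin r1 → ℝ) :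
    (Fin p0 → ℝ) × (ℝ → Fin p1 → ℝ) × (ℝ → Fin p1 → ℝ) :=
  ( B.b00 *ᵥ v + (∫ θ in a..b, B.b01 θ *ᵥ u1 θ) + (∫ ν in c..d, B.b02 ν *ᵥ u2 ν),
    fun x => B.b10 x *ᵥ v + PI1D a b B.b11 u1 x + (∫ ν in c..d, B.b12 x ν *ᵥ u2 ν),
    fun y => B.b20 y *ᵥ v + (∫ θ in a..b, B.b21 y θ *ᵥ u1 θ) + PI1D c d B.b22 u2 y )

/-- A family of (2D→011)-PI kernels of size `(p0,p1) × r`. -/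
structure PI2Dto011K (p0 p1 r : ℕ) where
  d0 : ℝ → ℝ → Matrix (Fin p0) (Fin r) ℝ
  d10 : ℝ → ℝ → Matrix (Fin p1) (Fin r) ℝ
  d11 : ℝ → ℝ → ℝ → Matrix (Fin p1) (Fin r) ℝ
  d12 : ℝ → ℝ → ℝ → Matrix (Fin p1) (Fin r) ℝ
  d20 : ℝ → ℝ → Matrix (Fin p1) (Fin r) ℝ
  d21 : ℝ → ℝ → ℝ → Matrix (Fin p1) (Fin r) ℝ
  d22 : ℝ → ℝ → ℝ → Matrix (Fin p1) (Fin r) ℝ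

/-- Continuity of a family of (2D→011)-PI kernels. -/
def PI2Dto011K.IsCont {p0 p1 r : ℕ} (a b c d : ℝ) (D : PI2Dto011K p0 p1 r) : Prop :=
  ContinuousOn (fun q : ℝ × ℝ => D.d0 q.1 q.2) (Icc a b ×ˢ Icc c d) ∧
  ContinuousOn (fun q : ℝ × ℝ => D.d10 q.1 q.2) (Icc a b ×ˢ Icc c d) ∧
  ContinuousOn (fun q : ℝ × ℝ × ℝ => D.d11 q.1 q.2.1 q.2.2)
    (Icc a b ×ˢ Icc c d ×ˢ Icc a b) ∧
  ContinuousOn (fun q : ℝ × ℝ × ℝ => D.d12 q.1 q.2.1 q.2.2)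
    (Icc a b ×ˢ Icc c d ×ˢ Icc a b) ∧
  ContinuousOn (fun q : ℝ × ℝ => D.d20 q.1 q.2) (Icc a b ×ˢ Icc c d) ∧
  ContinuousOn (fun q : ℝ × ℝ × ℝ => D.d21 q.1 q.2.1 q.2.2)
    (Icc a b ×ˢ Icc c d ×ˢ Icc c d) ∧
  ContinuousOn (fun q : ℝ × ℝ × ℝ => D.d22 q.1 q.2.1 q.2.2)
    (Icc a b ×ˢ Icc c d ×ˢ Icc c d)

/-- The (2D→011)-PI operator associated with the kernels `D`. -/
def PI2Dto011 {p0 p1 r : ℕ} (a b c d : ℝ) (D : PI2Dto011K p0 p1 r)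
    (u : ℝ → ℝ → Fin r → ℝ) :
    (Fin p0 → ℝ) × (ℝ → Fin p1 → ℝ) × (ℝ → Fin p1 → ℝ) :=
  ( ∫ θ in a..b, ∫ ν in c..d, D.d0 θ ν *ᵥ u θ ν,
    fun x => ∫ y in c..d,
      (D.d10 x y *ᵥ u x y + (∫ θ in a..x, D.d11 x y θ *ᵥ u θ y)
        + (∫ θ in x..b, D.d12 x y θ *ᵥ u θ y)),
    fun y => ∫ x in a..b,
      (D.d20 x y *ᵥ u x y + (∫ ν in c..y, D.d21 x y ν *ᵥ u x ν)
        + (∫ ν in y..d, D.d22 x y ν *ᵥ u x ν)) )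

/-- A family of (011→2D)-PI kernels of size `p × (r0,r1)`. -/
structure PI011to2DK (p r0 r1 : ℕ) where
  e0 : ℝ → ℝ → Matrix (Fin p) (Fin r0) ℝ
  e10 : ℝ → ℝ → Matrix (Fin p) (Fin r1) ℝ
  e11 : ℝ → ℝ → ℝ → Matrix (Fin p) (Fin r1) ℝ
  e12 : ℝ → ℝ → ℝ → Matrix (Fin p) (Fin r1) ℝ
  e20 : ℝ → ℝ → Matrix (Fin p) (Fin r1) ℝ
  e21 : ℝ → ℝ → ℝ → Matrix (Fin p) (Fin r1) ℝ
  e22 : ℝ → ℝ → ℝ → Matrix (Fin p) (Fin r1) ℝ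

/-- Continuity of a family of (011→2D)-PI kernels. -/
def PI011to2DK.IsCont {p r0 r1 : ℕ} (a b c d : ℝ) (E : PI011to2DK p r0 r1) : Prop :=
  ContinuousOn (fun q : ℝ × ℝ => E.e0 q.1 q.2) (Icc a b ×ˢ Icc c d) ∧
  ContinuousOn (fun q : ℝ × ℝ => E.e10 q.1 q.2) (Icc a b ×ˢ Icc c d) ∧
  ContinuousOn (fun q : ℝ × ℝ × ℝ => E.e11 q.1 q.2.1 q.2.2)
    (Icc a b ×ˢ Icc c d ×ˢ Icc a b) ∧
  ContinuousOn (fun q : ℝ × ℝ × ℝ => E.e12 q.1 q.2.1 q.2.2)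
    (Icc a b ×ˢ Icc c d ×ˢ Icc a b) ∧
  ContinuousOn (fun q : ℝ × ℝ => E.e20 q.1 q.2) (Icc a b ×ˢ Icc c d) ∧
  ContinuousOn (fun q : ℝ × ℝ × ℝ => E.e21 q.1 q.2.1 q.2.2)
    (Icc a b ×ˢ Icc c d ×ˢ Icc c d) ∧
  ContinuousOn (fun q : ℝ × ℝ × ℝ => E.e22 q.1 q.2.1 q.2.2)
    (Icc a b ×ˢ Icc c d ×ˢ Icc c d)

/-- The (011→2D)-PI operator associated with the kernels `E`. -/
def PI011to2D {p r0 r1 : ℕ} (a b c d : ℝ) (E : PI011to2DK p r0 r1)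
    (v : Fin r0 → ℝ) (u1 u2 : ℝ → Fin r1 → ℝ) (x y : ℝ) : Fin p → ℝ :=
  E.e0 x y *ᵥ v + E.e10 x y *ᵥ u1 x
  + (∫ θ in a..x, E.e11 x y θ *ᵥ u1 θ) + (∫ θ in x..b, E.e12 x y θ *ᵥ u1 θ)
  + E.e20 x y *ᵥ u2 y
  + (∫ ν in c..y, E.e21 x y ν *ᵥ u2 ν) + (∫ ν in y..d, E.e22 x y ν *ᵥ u2 ν)

/-- Interchange of the order of integration over the triangle `s ≤ θ ≤ η ≤ t`. -/
theorem intervalIntegral_triangle_swap {E : Type*} [NormedAddCommGroup E] [NormedSpace ℝ E]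
    {s t : ℝ} (hst : s ≤ t) {F : ℝ → ℝ → E} (hF : Continuous (Function.uncurry F)) :
    ∫ η in s..t, ∫ θ in s..η, F η θ = ∫ θ in s..t, ∫ η in θ..t, F η θ := by
  have lower : ∀ η ∈ Icc s t,
      ∫ θ in s..t, (Iic η).indicator (F η) θ = ∫ θ in s..η, F η θ := by
    intro η hη
    rw [intervalIntegral.integral_of_le hst, intervalIntegral.integral_of_le hη.1,
      setIntegral_indicator measurableSet_Iic, Ioc_inter_Iic, min_eq_right hη.2]
  have upper : ∀ θ ∈ Ioc s t,
      ∫ η in s..t, (Iic η).indicator (F η) θ = ∫ η in θ..t, F η θ := by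
    intro θ hθ
    have h1 : (fun η => (Iic η).indicator (F η) θ) = (Ici θ).indicator (fun η => F η θ) := by
      ext η
      simp [indicator]
    have h2 : Ioc s t ∩ Ici θ = Icc θ t := by
      ext η
      simp only [mem_inter_iff, mem_Ioc, mem_Ici, mem_Icc]
      have := hθ.1
      grind
    rw [h1, intervalIntegral.integral_of_le hst, intervalIntegral.integral_of_le hθ.2,
      setIntegral_indicator measurableSet_Ici, h2, integral_Icc_eq_integral_Ioc]
  have integrable : IntegrableOn (Function.uncurry fun η θ => (Iic η).indicator (F η) θ)
      (uIoc s t ×ˢ uIoc s t) (volume.prod volume) := by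
    have h : (Function.uncurry fun η θ => (Iic η).indicator (F η) θ)
        = {q : ℝ × ℝ | q.2 ≤ q.1}.indicator (Function.uncurry F) := by
      ext ⟨η, θ⟩
      simp [indicator]
    rw [h]
    refine IntegrableOn.indicator ?_ (measurableSet_le measurable_snd measurable_fst)
    exact (hF.continuousOn.integrableOn_compact
      (isCompact_uIcc.prod isCompact_uIcc)).mono_set
      (prod_mono uIoc_subset_uIcc uIoc_subset_uIcc)
  calc ∫ η in s..t, ∫ θ in s..η, F η θ
      = ∫ η in s..t, ∫ θ in s..t, (Iic η).indicator (F η) θ :=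
        intervalIntegral.integral_congr fun η hη =>
          (lower η (by rwa [uIcc_of_le hst] at hη)).symm
    _ = ∫ θ in s..t, ∫ η in s..t, (Iic η).indicator (F η) θ :=
        intervalIntegral_intervalIntegral_swap integrable
    _ = ∫ θ in s..t, ∫ η in θ..t, F η θ :=
        intervalIntegral.integral_congr_ae <| ae_of_all _ fun θ hθ =>
          upper θ (by rwa [uIoc_of_le hst] at hθ)

theorem continuous_intervalIntegral_of_continuous {X E : Type*} [TopologicalSpace X]
    [NormedAddCommGroup E] [NormedSpace ℝ E]
    {F : X → ℝ → E} (hF : Continuous (Function.uncurry F)) {s t : X → ℝ}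
    (hs : Continuous s) (ht : Continuous t) :
    Continuous fun x => ∫ η in s x..t x, F x η := by
  have h : (fun x => ∫ η in s x..t x, F x η)
      = fun x => (∫ η in (0 : ℝ)..t x, F x η) - ∫ η in (0 : ℝ)..s x, F x η := by
    ext x
    have hx : Continuous (F x) := hF.comp (by fun_prop : Continuous fun η => (x, η))
    exact (intervalIntegral.integral_interval_sub_left (hx.intervalIntegrable _ _)
      (hx.intervalIntegrable _ _)).symm
  rw [h]
  exact (intervalIntegral.continuous_parametric_intervalIntegral_of_continuous hF ht).sub
    (intervalIntegral.continuous_parametric_intervalIntegral_of_continuous hF hs)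

theorem continuous_mInt {X : Type*} [TopologicalSpace X] {p r : ℕ}
    {F : X → ℝ → Matrix (Fin p) (Fin r) ℝ} (hF : Continuous (Function.uncurry F))
    {s t : X → ℝ} (hs : Continuous s) (ht : Continuous t) :
    Continuous fun x => mInt (s x) (t x) (F x) :=
  continuous_matrix fun i j =>
    continuous_intervalIntegral_of_continuous (hF.matrix_elem i j) hs ht

theorem mInt_congr {p r : ℕ} {s t : ℝ} {F G : ℝ → Matrix (Fin p) (Fin r) ℝ}
    (h : EqOn F G (uIcc s t)) : mInt s t F = mInt s t G := by
  ext i j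
  exact intervalIntegral.integral_congr fun η hη => congrFun (congrFun (h hη) i) j

theorem mulVec_intervalIntegral {p r : ℕ} (A : Matrix (Fin p) (Fin r) ℝ) {v : ℝ → Fin r → ℝ}
    (hv : Continuous v) (s t : ℝ) :
    A *ᵥ (∫ θ in s..t, v θ) = ∫ θ in s..t, A *ᵥ v θ :=
  ((LinearMap.toContinuousLinearMap A.mulVecLin).intervalIntegral_comp_comm
    (hv.intervalIntegrable s t)).symm

theorem intervalIntegral_pi_apply {r : ℕ} {v : ℝ → Fin r → ℝ}
    (hv : Continuous v) (s t : ℝ) (i : Fin r) :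
    (∫ θ in s..t, v θ) i = ∫ θ in s..t, v θ i :=
  ((ContinuousLinearMap.proj (R := ℝ) (φ := fun _ : Fin r => ℝ) i).intervalIntegral_comp_comm
    (hv.intervalIntegrable s t)).symm

theorem mInt_mulVec {p r : ℕ} {F : ℝ → Matrix (Fin p) (Fin r) ℝ} (hF : Continuous F)
    (v : Fin r → ℝ) (s t : ℝ) :
    mInt s t F *ᵥ v = ∫ η in s..t, F η *ᵥ v := by
  ext i
  rw [intervalIntegral_pi_apply (by fun_prop)]
  have hint : ∀ j ∈ Finset.univ,
      IntervalIntegrable (fun η => F η i j * v j) volume s t := fun j _ =>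
    ((hF.matrix_elem i j).mul continuous_const).intervalIntegrable s t
  simp only [mulVec, dotProduct, mInt, of_apply]
  rw [intervalIntegral.integral_finsetSum hint]
  simp only [intervalIntegral.integral_mul_const]

namespace PI1DK

variable {p r : ℕ}

/-- Joint continuity of a family of 1D-PI kernels on the whole line. -/
structure IsGloballyCont (N : PI1DK p r) : Prop where
  k0 : Continuous N.k0
  k1 : Continuous (Function.uncurry N.k1)
  k2 : Continuous (Function.uncurry N.k2)

/-- Agreement of two families of 1D-PI kernels on `[s,t]`. -/
structure AgreeOn (s t : ℝ) (N N' : PI1DK p r) : Prop where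
  k0 : ∀ x ∈ Icc s t, N.k0 x = N'.k0 x
  k1 : ∀ x ∈ Icc s t, ∀ θ ∈ Icc s t, N.k1 x θ = N'.k1 x θ
  k2 : ∀ x ∈ Icc s t, ∀ θ ∈ Icc s t, N.k2 x θ = N'.k2 x θ

/-- The kernels `N` extended from `[s,t]` by projecting the variables onto that interval. -/
def extend {s t : ℝ} (h : s ≤ t) (N : PI1DK p r) : PI1DK p r where
  k0 x := N.k0 (projIcc s t h x)
  k1 x θ := N.k1 (projIcc s t h x) (projIcc s t h θ)
  k2 x θ := N.k2 (projIcc s t h x) (projIcc s t h θ)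

theorem agreeOn_extend {s t : ℝ} (h : s ≤ t) (N : PI1DK p r) : N.AgreeOn s t (N.extend h) := by
  constructor
  · intro x hx
    simp [extend, projIcc_of_mem h hx]
  · intro x hx θ hθ
    simp [extend, projIcc_of_mem h hx, projIcc_of_mem h hθ]
  · intro x hx θ hθ
    simp [extend, projIcc_of_mem h hx, projIcc_of_mem h hθ]

theorem IsCont.isGloballyCont_extend {s t : ℝ} (h : s ≤ t) {N : PI1DK p r}
    (hN : N.IsCont s t) : (N.extend h).IsGloballyCont := by
  have hproj : Continuous fun x => (projIcc s t h x : ℝ) :=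
    continuous_subtype_val.comp continuous_projIcc
  have hproj2 : Continuous fun q : ℝ × ℝ =>
      ((projIcc s t h q.1 : ℝ), (projIcc s t h q.2 : ℝ)) :=
    (hproj.comp continuous_fst).prodMk (hproj.comp continuous_snd)
  exact ⟨hN.1.comp_continuous hproj fun x => (projIcc s t h x).2,
    hN.2.1.comp_continuous hproj2 fun q => ⟨(projIcc s t h q.1).2, (projIcc s t h q.2).2⟩,
    hN.2.2.comp_continuous hproj2 fun q => ⟨(projIcc s t h q.1).2, (projIcc s t h q.2).2⟩⟩

theorem IsGloballyCont.isCont {N : PI1DK p r} (hN : N.IsGloballyCont) (s t : ℝ) :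
    N.IsCont s t :=
  ⟨hN.k0.continuousOn, hN.k1.continuousOn, hN.k2.continuousOn⟩

theorem IsCont.congr {s t : ℝ} {N N' : PI1DK p r} (hN' : N'.IsCont s t)
    (h : N.AgreeOn s t N') : N.IsCont s t :=
  ⟨hN'.1.congr h.k0, hN'.2.1.congr fun q hq => h.k1 q.1 hq.1 q.2 hq.2,
    hN'.2.2.congr fun q hq => h.k2 q.1 hq.1 q.2 hq.2⟩

end PI1DK

theorem PI1D_congr {p r : ℕ} {s t : ℝ} {N N' : PI1DK p r} (h : N.AgreeOn s t N')
    {u u' : ℝ → Fin r → ℝ} (hu : EqOn u u' (Icc s t)) :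
    EqOn (PI1D s t N u) (PI1D s t N' u') (Icc s t) := by
  intro x hx
  have hst : s ≤ t := hx.1.trans hx.2
  have hs : s ∈ Icc s t := left_mem_Icc.2 hst
  have ht : t ∈ Icc s t := right_mem_Icc.2 hst
  unfold PI1D
  rw [h.k0 x hx, hu hx]
  congr 1
  · congr 1
    refine intervalIntegral.integral_congr fun θ hθ => ?_
    have hθ' := uIcc_subset_Icc hs hx hθ
    simp only [h.k1 x hx θ hθ', hu hθ']
  · refine intervalIntegral.integral_congr fun θ hθ => ?_
    have hθ' := uIcc_subset_Icc hx ht hθ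
    simp only [h.k2 x hx θ hθ', hu hθ']

namespace PI1DK

variable {n p m : ℕ}

/-- The kernels of the composition of two 1D-PI operators on `[a,b]`. -/
def comp (a b : ℝ) (N : PI1DK n p) (M : PI1DK p m) : PI1DK n m where
  k0 x := N.k0 x * M.k0 x
  k1 x θ := N.k0 x * M.k1 x θ + N.k1 x θ * M.k0 θ
        + mInt θ x (fun η => N.k1 x η * M.k1 η θ)
        + mInt a θ (fun η => N.k1 x η * M.k2 η θ)
        + mInt x b (fun η => N.k2 x η * M.k1 η θ)
  k2 x θ := N.k0 x * M.k2 x θ + N.k2 x θ * M.k0 θ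
        + mInt x θ (fun η => N.k2 x η * M.k2 η θ)
        + mInt a x (fun η => N.k1 x η * M.k2 η θ)
        + mInt θ b (fun η => N.k2 x η * M.k1 η θ)

theorem AgreeOn.comp {a b : ℝ} {N N' : PI1DK n p} {M M' : PI1DK p m}
    (hN : N.AgreeOn a b N') (hM : M.AgreeOn a b M') :
    (N.comp a b M).AgreeOn a b (N'.comp a b M') := by
  have key {s t x θ : ℝ} (hs : s ∈ Icc a b) (ht : t ∈ Icc a b)
      {K K' : ℝ → ℝ → Matrix (Fin n) (Fin p) ℝ}
      {L L' : ℝ → ℝ → Matrix (Fin p) (Fin m) ℝ}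
      (hK : ∀ x ∈ Icc a b, ∀ θ ∈ Icc a b, K x θ = K' x θ)
      (hL : ∀ x ∈ Icc a b, ∀ θ ∈ Icc a b, L x θ = L' x θ)
      (hx : x ∈ Icc a b) (hθ : θ ∈ Icc a b) :
      mInt s t (fun η => K x η * L η θ) = mInt s t (fun η => K' x η * L' η θ) := by
    refine mInt_congr fun η hη => ?_
    have hη' := uIcc_subset_Icc hs ht hη
    simp only [hK x hx η hη', hL η hη' θ hθ]
  constructor
  · intro x hx
    simp only [PI1DK.comp, hN.k0 x hx, hM.k0 x hx]
  · intro x hx θ hθ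
    have hab : a ≤ b := hx.1.trans hx.2
    have ha : a ∈ Icc a b := left_mem_Icc.2 hab
    have hb : b ∈ Icc a b := right_mem_Icc.2 hab
    simp only [PI1DK.comp, hN.k0 x hx, hM.k1 x hx θ hθ, hN.k1 x hx θ hθ, hM.k0 θ hθ,
      key hθ hx hN.k1 hM.k1 hx hθ, key ha hθ hN.k1 hM.k2 hx hθ, key hx hb hN.k2 hM.k1 hx hθ]
  · intro x hx θ hθ
    have hab : a ≤ b := hx.1.trans hx.2
    have ha : a ∈ Icc a b := left_mem_Icc.2 hab
    have hb : b ∈ Icc a b := right_mem_Icc.2 hab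
    simp only [PI1DK.comp, hN.k0 x hx, hM.k2 x hx θ hθ, hN.k2 x hx θ hθ, hM.k0 θ hθ,
      key hx hθ hN.k2 hM.k2 hx hθ, key ha hx hN.k1 hM.k2 hx hθ, key hθ hb hN.k2 hM.k1 hx hθ]

theorem IsGloballyCont.comp {N : PI1DK n p} {M : PI1DK p m} (hN : N.IsGloballyCont)
    (hM : M.IsGloballyCont) (a b : ℝ) : (N.comp a b M).IsGloballyCont := by
  have key {K : ℝ → ℝ → Matrix (Fin n) (Fin p) ℝ} {L : ℝ → ℝ → Matrix (Fin p) (Fin m) ℝ}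
      (hK : Continuous (Function.uncurry K)) (hL : Continuous (Function.uncurry L))
      {s t : ℝ × ℝ → ℝ} (hs : Continuous s) (ht : Continuous t) :
      Continuous fun q : ℝ × ℝ => mInt (s q) (t q) (fun η => K q.1 η * L η q.2) := by
    refine continuous_mInt ?_ hs ht
    exact (hK.comp (by fun_prop : Continuous fun z : (ℝ × ℝ) × ℝ => (z.1.1, z.2))).matrix_mul
      (hL.comp (by fun_prop : Continuous fun z : (ℝ × ℝ) × ℝ => (z.2, z.1.2)))
  refine ⟨hN.k0.matrix_mul hM.k0, ?_, ?_⟩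
  · exact (((((hN.k0.comp continuous_fst).matrix_mul hM.k1).add
      (hN.k1.matrix_mul (hM.k0.comp continuous_snd))).add
      (key hN.k1 hM.k1 continuous_snd continuous_fst)).add
      (key hN.k1 hM.k2 continuous_const continuous_snd)).add
      (key hN.k2 hM.k1 continuous_fst continuous_const)
  · exact (((((hN.k0.comp continuous_fst).matrix_mul hM.k2).add
      (hN.k2.matrix_mul (hM.k0.comp continuous_snd))).add
      (key hN.k2 hM.k2 continuous_fst continuous_snd)).add
      (key hN.k1 hM.k2 continuous_const continuous_fst)).add
      (key hN.k2 hM.k1 continuous_snd continuous_const)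

end PI1DK

/-- The composition formula for 1D-PI operators whose kernels are continuous on the line. -/
theorem PI1D_PI1D_of_isGloballyCont {n p m : ℕ} {a b : ℝ} {N : PI1DK n p} {M : PI1DK p m}
    (hN : N.IsGloballyCont) (hM : M.IsGloballyCont) {u : ℝ → Fin m → ℝ} (hu : Continuous u)
    {x : ℝ} (hx : x ∈ Icc a b) :
    PI1D a b N (PI1D a b M u) x = PI1D a b (N.comp a b M) u x := by
  have cN1 : Continuous (N.k1 x) := hN.k1.comp (by fun_prop : Continuous fun η => (x, η))
  have cN2 : Continuous (N.k2 x) := hN.k2.comp (by fun_prop : Continuous fun η => (x, η))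
  have cM1r (η : ℝ) : Continuous (M.k1 η) :=
    hM.k1.comp (by fun_prop : Continuous fun θ => (η, θ))
  have cM2r (η : ℝ) : Continuous (M.k2 η) :=
    hM.k2.comp (by fun_prop : Continuous fun θ => (η, θ))
  have cM1l (θ : ℝ) : Continuous fun η => M.k1 η θ :=
    hM.k1.comp (by fun_prop : Continuous fun η => (η, θ))
  have cM2l (θ : ℝ) : Continuous fun η => M.k2 η θ :=
    hM.k2.comp (by fun_prop : Continuous fun η => (η, θ))
  have cM0 := hM.k0
  have cW {K : ℝ → Matrix (Fin n) (Fin p) ℝ} {L : ℝ → ℝ → Matrix (Fin p) (Fin m) ℝ}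
      (hK : Continuous K) (hL : Continuous (Function.uncurry L)) :
      Continuous (Function.uncurry fun η θ => (K η * L η θ) *ᵥ u θ) :=
    ((hK.comp continuous_fst).matrix_mul hL).matrix_mulVec (hu.comp continuous_snd)
  have w11 := cW cN1 hM.k1
  have w12 := cW cN1 hM.k2
  have w21 := cW cN2 hM.k1
  have w22 := cW cN2 hM.k2
  have flip {W : ℝ → ℝ → Fin n → ℝ} (hW : Continuous (Function.uncurry W)) :
      Continuous (Function.uncurry fun θ η => W η θ) := hW.comp continuous_swap
  have integrable_param {W : ℝ → ℝ → Fin n → ℝ} (hW : Continuous (Function.uncurry W)) {s t : ℝ → ℝ}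
      (hs : Continuous s) (ht : Continuous t) (c d : ℝ) :
      IntervalIntegrable (fun η => ∫ θ in s η..t η, W η θ) volume c d :=
    (continuous_intervalIntegral_of_continuous hW hs ht).intervalIntegrable c d
  have integrable_lower {W : ℝ → ℝ → Fin n → ℝ} (hW : Continuous (Function.uncurry W))
      (f c d : ℝ) : IntervalIntegrable (fun η => ∫ θ in η..f, W η θ) volume c d :=
    integrable_param hW continuous_id continuous_const c d
  have integrable_upper {W : ℝ → ℝ → Fin n → ℝ} (hW : Continuous (Function.uncurry W))
      (e c d : ℝ) : IntervalIntegrable (fun η => ∫ θ in e..η, W η θ) volume c d :=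
    integrable_param hW continuous_const continuous_id c d
  have integrable_const {W : ℝ → ℝ → Fin n → ℝ} (hW : Continuous (Function.uncurry W))
      (e f c d : ℝ) : IntervalIntegrable (fun η => ∫ θ in e..f, W η θ) volume c d :=
    integrable_param hW continuous_const continuous_const c d
  have rect {W : ℝ → ℝ → Fin n → ℝ} (hW : Continuous (Function.uncurry W)) (c d e f : ℝ) :
      ∫ η in c..d, ∫ θ in e..f, W η θ = ∫ θ in e..f, ∫ η in c..d, W η θ :=
    intervalIntegral_intervalIntegral_swap ((hW.continuousOn.integrableOn_compact
      (isCompact_uIcc.prod isCompact_uIcc)).mono_set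
      (prod_mono uIoc_subset_uIcc uIoc_subset_uIcc))
  have split {W : ℝ → ℝ → Fin n → ℝ} (hW : Continuous (Function.uncurry W)) (η c d e : ℝ) :
      ∫ θ in c..e, W η θ = (∫ θ in c..d, W η θ) + ∫ θ in d..e, W η θ := by
    have h : Continuous (W η) := hW.comp (by fun_prop : Continuous fun θ => (η, θ))
    exact (intervalIntegral.integral_add_adjacent_intervals (h.intervalIntegrable _ _)
      (h.intervalIntegrable _ _)).symm
  have split_lower {W : ℝ → ℝ → Fin n → ℝ} (hW : Continuous (Function.uncurry W))
      (c d e f : ℝ) : ∫ η in c..d, ∫ θ in η..f, W η θ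
        = (∫ η in c..d, ∫ θ in η..e, W η θ) + ∫ η in c..d, ∫ θ in e..f, W η θ := by
    rw [← intervalIntegral.integral_add (integrable_lower hW e c d)
      (integrable_const hW e f c d)]
    exact intervalIntegral.integral_congr fun η _ => split hW η η e f
  have split_upper {W : ℝ → ℝ → Fin n → ℝ} (hW : Continuous (Function.uncurry W))
      (c d e f : ℝ) : ∫ η in c..d, ∫ θ in e..η, W η θ
        = (∫ η in c..d, ∫ θ in e..f, W η θ) + ∫ η in c..d, ∫ θ in f..η, W η θ := by
    rw [← intervalIntegral.integral_add (integrable_const hW e f c d)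
      (integrable_upper hW f c d)]
    exact intervalIntegral.integral_congr fun η _ => split hW η e f η
  -- the inner operator, after multiplication by a matrix
  have inner (A : Matrix (Fin n) (Fin p) ℝ) (η : ℝ) : A *ᵥ PI1D a b M u η
      = (A * M.k0 η) *ᵥ u η + (∫ θ in a..η, (A * M.k1 η θ) *ᵥ u θ)
        + ∫ θ in η..b, (A * M.k2 η θ) *ᵥ u θ := by
    have h1 := cM1r η
    have h2 := cM2r η
    simp only [PI1D, mulVec_add, mulVec_mulVec]
    rw [mulVec_intervalIntegral A (by fun_prop), mulVec_intervalIntegral A (by fun_prop)]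
    simp only [mulVec_mulVec]
  have outer1 : ∫ η in a..x, N.k1 x η *ᵥ PI1D a b M u η
      = (∫ η in a..x, (N.k1 x η * M.k0 η) *ᵥ u η)
        + (∫ θ in a..x, ∫ η in θ..x, (N.k1 x η * M.k1 η θ) *ᵥ u θ)
        + ((∫ θ in a..x, ∫ η in a..θ, (N.k1 x η * M.k2 η θ) *ᵥ u θ)
        + ∫ θ in x..b, ∫ η in a..x, (N.k1 x η * M.k2 η θ) *ᵥ u θ) := by
    have h0 : IntervalIntegrable (fun η => (N.k1 x η * M.k0 η) *ᵥ u η) volume a x :=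
      Continuous.intervalIntegrable (by fun_prop) _ _
    simp only [inner]
    rw [intervalIntegral.integral_add (h0.add (integrable_upper w11 _ _ _))
      (integrable_lower w12 _ _ _),
      intervalIntegral.integral_add h0 (integrable_upper w11 _ _ _),
      split_lower w12 a x x b, rect w12 a x x b,
      ← intervalIntegral_triangle_swap hx.1 (flip w12), intervalIntegral_triangle_swap hx.1 w11]
  have outer2 : ∫ η in x..b, N.k2 x η *ᵥ PI1D a b M u η
      = (∫ η in x..b, (N.k2 x η * M.k0 η) *ᵥ u η)
        + ((∫ θ in a..x, ∫ η in x..b, (N.k2 x η * M.k1 η θ) *ᵥ u θ)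
        + ∫ θ in x..b, ∫ η in θ..b, (N.k2 x η * M.k1 η θ) *ᵥ u θ)
        + ∫ θ in x..b, ∫ η in x..θ, (N.k2 x η * M.k2 η θ) *ᵥ u θ := by
    have h0 : IntervalIntegrable (fun η => (N.k2 x η * M.k0 η) *ᵥ u η) volume x b :=
      Continuous.intervalIntegrable (by fun_prop) _ _
    simp only [inner]
    rw [intervalIntegral.integral_add (h0.add (integrable_upper w21 _ _ _))
      (integrable_lower w22 _ _ _),
      intervalIntegral.integral_add h0 (integrable_upper w21 _ _ _),
      split_upper w21 x b a x, rect w21 x b a x,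
      ← intervalIntegral_triangle_swap hx.2 (flip w22), intervalIntegral_triangle_swap hx.2 w21]
  have comp1 : ∫ θ in a..x, (N.comp a b M).k1 x θ *ᵥ u θ
      = (∫ θ in a..x, (N.k0 x * M.k1 x θ) *ᵥ u θ) + (∫ θ in a..x, (N.k1 x θ * M.k0 θ) *ᵥ u θ)
        + (∫ θ in a..x, ∫ η in θ..x, (N.k1 x η * M.k1 η θ) *ᵥ u θ)
        + (∫ θ in a..x, ∫ η in a..θ, (N.k1 x η * M.k2 η θ) *ᵥ u θ)
        + ∫ θ in a..x, ∫ η in x..b, (N.k2 x η * M.k1 η θ) *ᵥ u θ := by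
    have hM1 := cM1r x
    have h1 : IntervalIntegrable (fun θ => (N.k0 x * M.k1 x θ) *ᵥ u θ) volume a x :=
      Continuous.intervalIntegrable (by fun_prop) _ _
    have h2 : IntervalIntegrable (fun θ => (N.k1 x θ * M.k0 θ) *ᵥ u θ) volume a x :=
      Continuous.intervalIntegrable (by fun_prop) _ _
    have h3 := integrable_lower (flip w11) x a x
    have h4 := integrable_upper (flip w12) a a x
    have h5 := integrable_const (flip w21) x b a x
    rw [← intervalIntegral.integral_add h1 h2, ← intervalIntegral.integral_add (h1.add h2) h3,
      ← intervalIntegral.integral_add ((h1.add h2).add h3) h4,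
      ← intervalIntegral.integral_add (((h1.add h2).add h3).add h4) h5]
    refine intervalIntegral.integral_congr fun θ _ => ?_
    simp only [PI1DK.comp, add_mulVec]
    rw [mInt_mulVec (cN1.matrix_mul (cM1l θ)), mInt_mulVec (cN1.matrix_mul (cM2l θ)),
      mInt_mulVec (cN2.matrix_mul (cM1l θ))]
  have comp2 : ∫ θ in x..b, (N.comp a b M).k2 x θ *ᵥ u θ
      = (∫ θ in x..b, (N.k0 x * M.k2 x θ) *ᵥ u θ) + (∫ θ in x..b, (N.k2 x θ * M.k0 θ) *ᵥ u θ)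
        + (∫ θ in x..b, ∫ η in x..θ, (N.k2 x η * M.k2 η θ) *ᵥ u θ)
        + (∫ θ in x..b, ∫ η in a..x, (N.k1 x η * M.k2 η θ) *ᵥ u θ)
        + ∫ θ in x..b, ∫ η in θ..b, (N.k2 x η * M.k1 η θ) *ᵥ u θ := by
    have hM2 := cM2r x
    have h1 : IntervalIntegrable (fun θ => (N.k0 x * M.k2 x θ) *ᵥ u θ) volume x b :=
      Continuous.intervalIntegrable (by fun_prop) _ _
    have h2 : IntervalIntegrable (fun θ => (N.k2 x θ * M.k0 θ) *ᵥ u θ) volume x b :=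
      Continuous.intervalIntegrable (by fun_prop) _ _
    have h3 := integrable_upper (flip w22) x x b
    have h4 := integrable_const (flip w12) a x x b
    have h5 := integrable_lower (flip w21) b x b
    rw [← intervalIntegral.integral_add h1 h2, ← intervalIntegral.integral_add (h1.add h2) h3,
      ← intervalIntegral.integral_add ((h1.add h2).add h3) h4,
      ← intervalIntegral.integral_add (((h1.add h2).add h3).add h4) h5]
    refine intervalIntegral.integral_congr fun θ _ => ?_
    simp only [PI1DK.comp, add_mulVec]
    rw [mInt_mulVec (cN2.matrix_mul (cM2l θ)), mInt_mulVec (cN1.matrix_mul (cM2l θ)),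
      mInt_mulVec (cN2.matrix_mul (cM1l θ))]
  rw [PI1D, inner, outer1, outer2, PI1D, comp1, comp2, PI1DK.comp]
  abel

/-- Composition of 1D-PI operators is a 1D-PI operator, with explicitly
given composite kernels. -/
theorem composition_of_1D_PI_operators {n p m : ℕ} (a b : ℝ) (hab : a < b)
    (N : PI1DK n p) (M : PI1DK p m)
    (hN : N.IsCont a b) (hM : M.IsCont a b)
    (Q : PI1DK n m)
    (hQ0 : ∀ x, Q.k0 x = N.k0 x * M.k0 x)
    (hQ1 : ∀ x θ, Q.k1 x θ =
      N.k0 x * M.k1 x θ + N.k1 x θ * M.k0 θ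
        + mInt θ x (fun η => N.k1 x η * M.k1 η θ)
        + mInt a θ (fun η => N.k1 x η * M.k2 η θ)
        + mInt x b (fun η => N.k2 x η * M.k1 η θ))
    (hQ2 : ∀ x θ, Q.k2 x θ =
      N.k0 x * M.k2 x θ + N.k2 x θ * M.k0 θ
        + mInt x θ (fun η => N.k2 x η * M.k2 η θ)
        + mInt a x (fun η => N.k1 x η * M.k2 η θ)
        + mInt θ b (fun η => N.k2 x η * M.k1 η θ)) :
    Q.IsCont a b ∧
      ∀ u : ℝ → Fin m → ℝ, ContinuousOn u (Icc a b) →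
        ∀ x ∈ Icc a b, PI1D a b N (PI1D a b M u) x = PI1D a b Q u x := by
  have hle := hab.le
  have hQ : Q = N.comp a b M := by
    cases Q
    simp only [PI1DK.comp, PI1DK.mk.injEq]
    exact ⟨funext hQ0, funext fun x => funext (hQ1 x), funext fun x => funext (hQ2 x)⟩
  subst hQ
  have hN' := hN.isGloballyCont_extend hle
  have hM' := hM.isGloballyCont_extend hle
  have eN := N.agreeOn_extend hle
  have eM := M.agreeOn_extend hle
  refine ⟨((hN'.comp hM' a b).isCont a b).congr (eN.comp eM), fun u hu x hx => ?_⟩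
  have hu' : Continuous (IccExtend hle ((Icc a b).domRestrict u)) :=
    (continuousOn_iff_continuous_domRestrict.1 hu).Icc_extend'
  have eu : EqOn u (IccExtend hle ((Icc a b).domRestrict u)) (Icc a b) := fun y hy =>
    (IccExtend_of_mem hle ((Icc a b).domRestrict u) hy).symm
  rw [PI1D_congr eN (PI1D_congr eM eu) hx, PI1D_PI1D_of_isGloballyCont hN' hM' hu' hx,
    PI1D_congr (eN.comp eM) eu hx]
end
end

section
/- For any family N of 2D-PI kernels of size n×p and any family M of 2D-PI kernels of size p×m, there exists a family Q of 2D-PI kernels of size n×m such that for every continuous u : [a,b]×[c,d] → ℝ^m and every (x,y) ∈ [a,b]×[c,d], (P[N](P[M]u))(x,y) = (P[Q]u)(x,y). In other words, the 2D-PI operators are closed under composition. -/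
open Matrix MeasureTheory Set

noncomputable section

section
variable {E F : Type*} [NormedAddCommGroup E] [NormedSpace ℝ E]
  [NormedAddCommGroup F] [NormedSpace ℝ F]

theorem intervalIntegral_triangle_swap_of_le {f : ℝ → ℝ → E} (hf : Continuous f.uncurry)
    {a x : ℝ} (hax : a ≤ x) :
    ∫ θ in a..x, ∫ η in a..θ, f θ η = ∫ η in a..x, ∫ θ in η..x, f θ η := by
  have h1 : ∀ θ ∈ Ioc a x, ∫ η in a..θ, f θ η
      = ∫ η in Ioc a x, (Iic θ).indicator (f θ) η := by
    intro θ hθ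
    rw [intervalIntegral.integral_of_le hθ.1.le, setIntegral_indicator measurableSet_Iic,
      Ioc_inter_Iic, min_eq_right hθ.2]
  have h2 : ∀ η ∈ Ioc a x, ∫ θ in η..x, f θ η
      = ∫ θ in Ioc a x, (Iic θ).indicator (f θ) η := by
    intro η hη
    rw [intervalIntegral.integral_of_le hη.2, ← integral_Icc_eq_integral_Ioc]
    have : ∀ θ, (Iic θ).indicator (f θ) η = (Ici η).indicator (fun θ => f θ η) θ := by
      intro θ; simp [indicator]
    simp_rw [this]
    rw [setIntegral_indicator measurableSet_Ici]
    congr 2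
    ext t; simp; constructor
    · rintro ⟨h, h'⟩; exact ⟨⟨hη.1.trans_le h, h'⟩, h⟩
    · rintro ⟨⟨_, h'⟩, h⟩; exact ⟨h, h'⟩
  rw [intervalIntegral.integral_of_le hax, intervalIntegral.integral_of_le hax,
    setIntegral_congr_fun measurableSet_Ioc h1, setIntegral_congr_fun measurableSet_Ioc h2]
  apply integral_integral_swap
  have h3 : (Function.uncurry fun θ η => (Iic θ).indicator (f θ) η)
      = {q : ℝ × ℝ | q.2 ≤ q.1}.indicator f.uncurry := by
    ext ⟨θ, η⟩; simp [indicator]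
  rw [h3, Measure.prod_restrict]
  refine Integrable.indicator ?_ (measurableSet_le measurable_snd measurable_fst)
  exact ((hf.continuousOn.integrableOn_compact (isCompact_Icc.prod isCompact_Icc)).mono_set
    (prod_mono Ioc_subset_Icc_self Ioc_subset_Icc_self))

theorem intervalIntegral_triangle_swap_s1 {f : ℝ → ℝ → E} (hf : Continuous f.uncurry) (a x : ℝ) :
    ∫ θ in a..x, ∫ η in a..θ, f θ η = ∫ η in a..x, ∫ θ in η..x, f θ η := by
  rcases le_total a x with h | h
  · exact intervalIntegral_triangle_swap_of_le hf h
  · have := intervalIntegral_triangle_swap_of_le (f := fun s t => f t s)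
      (hf.comp continuous_swap) h
    rw [intervalIntegral.integral_symm x a, intervalIntegral.integral_symm x a]
    simp_rw [intervalIntegral.integral_symm _ a, intervalIntegral.integral_symm x _,
      intervalIntegral.integral_neg]
    rw [this]

/-- Point evaluation at `t` with weight `e`, plus integration from `p` to `q`. -/
def evalAddIntegral (e t p q : ℝ) (f : ℝ → E) : E := e • f t + ∫ s in p..q, f s

@[fun_prop]
theorem continuous_evalAddIntegral {X : Type*} [TopologicalSpace X] {e : ℝ}
    {f : X → ℝ → E} {t p q : X → ℝ} (hf : Continuous f.uncurry)
    (ht : Continuous t) (hp : Continuous p) (hq : Continuous q) :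
    Continuous fun z => evalAddIntegral e (t z) (p z) (q z) (f z) := by
  have hf' : ∀ z, Continuous (f z) := fun z => hf.comp (Continuous.prodMk_right z)
  have hsub : ∀ z, ∫ s in p z..q z, f z s = (∫ s in 0..q z, f z s) - ∫ s in 0..p z, f z s :=
    fun z => (intervalIntegral.integral_interval_sub_left
      ((hf' z).intervalIntegrable _ _) ((hf' z).intervalIntegrable _ _)).symm
  simp only [evalAddIntegral, hsub]
  refine ((hf.comp (continuous_id.prodMk ht)).const_smul e).add ?_
  fun_prop

theorem evalAddIntegral_sum {ι : Type*} [Fintype ι] (e t p q : ℝ) {f : ι → ℝ → E}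
    (hf : ∀ i, Continuous (f i)) :
    evalAddIntegral e t p q (fun s => ∑ i, f i s) = ∑ i, evalAddIntegral e t p q (f i) := by
  simp only [evalAddIntegral]
  rw [intervalIntegral.integral_finsetSum fun i _ => (hf i).intervalIntegrable _ _,
    Finset.smul_sum, Finset.sum_add_distrib]

theorem ContinuousLinearMap.map_evalAddIntegral [CompleteSpace E] [CompleteSpace F]
    (L : E →L[ℝ] F) (e t p q : ℝ) {f : ℝ → E} (hf : Continuous f) :
    L (evalAddIntegral e t p q f) = evalAddIntegral e t p q (fun s => L (f s)) := by
  simp only [evalAddIntegral, map_add, map_smul]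
  rw [L.intervalIntegral_comp_comm (hf.intervalIntegrable _ _)]

theorem evalAddIntegral_apply [CompleteSpace E] [CompleteSpace F] (e t p q : ℝ)
    {f : ℝ → E →L[ℝ] F} (hf : Continuous f) (v : E) :
    evalAddIntegral e t p q f v = evalAddIntegral e t p q (fun s => f s v) :=
  (ContinuousLinearMap.apply ℝ F v).map_evalAddIntegral e t p q hf

theorem evalAddIntegral_comm [CompleteSpace E] (e t p q e' t' p' q' : ℝ) {f : ℝ → ℝ → E}
    (hf : Continuous f.uncurry) :
    evalAddIntegral e t p q (fun θ => evalAddIntegral e' t' p' q' (fun ν => f θ ν)) =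
      evalAddIntegral e' t' p' q' (fun ν => evalAddIntegral e t p q (fun θ => f θ ν)) := by
  have h1 : ∀ θ, Continuous (f θ) := fun θ => hf.comp (Continuous.prodMk_right θ)
  have h2 : ∀ ν, Continuous fun θ => f θ ν := fun ν => hf.comp (Continuous.prodMk_left ν)
  have h3 : Continuous (fun ν θ => f θ ν).uncurry := hf.comp continuous_swap
  have hswap := intervalIntegral_intervalIntegral_swap (F := f) (a := p) (b := q) (c := p')
    (d := q') ((hf.continuousOn.integrableOn_compact
      (isCompact_uIcc.prod isCompact_uIcc)).mono_set
        (prod_mono uIoc_subset_uIcc uIoc_subset_uIcc))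
  simp only [evalAddIntegral]
  rw [intervalIntegral.integral_add, intervalIntegral.integral_add, hswap,
    intervalIntegral.integral_smul, intervalIntegral.integral_smul, smul_add, smul_add,
    smul_comm e e']
  · abel
  all_goals apply Continuous.intervalIntegrable
  · exact (h1 t).const_smul e
  · exact intervalIntegral.continuous_parametric_intervalIntegral_of_continuous' h3 _ _
  · exact (h2 t').const_smul e'
  · exact intervalIntegral.continuous_parametric_intervalIntegral_of_continuous' hf _ _

/-- The three terms of a 1D-PI operator on `[a,b]`: evaluation at `x`, integration over `[a,x]`
and integration over `[x,b]`. -/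
def PI1DTerm (a b : ℝ) (i : Fin 3) (x : ℝ) (f : ℝ → E) : E :=
  evalAddIntegral (![1, 0, 0] i) x (![a, a, x] i) (![a, x, b] i) f

@[simp] theorem PI1DTerm_zero (a b x : ℝ) (f : ℝ → E) : PI1DTerm a b 0 x f = f x := by
  simp [PI1DTerm, evalAddIntegral]

@[simp] theorem PI1DTerm_one (a b x : ℝ) (f : ℝ → E) :
    PI1DTerm a b 1 x f = ∫ s in a..x, f s := by
  simp [PI1DTerm, evalAddIntegral]

@[simp] theorem PI1DTerm_two (a b x : ℝ) (f : ℝ → E) :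
    PI1DTerm a b 2 x f = ∫ s in x..b, f s := by
  simp [PI1DTerm, evalAddIntegral]

@[fun_prop]
theorem continuous_PI1DTerm {X : Type*} [TopologicalSpace X] {a b : ℝ} {i : Fin 3}
    {f : X → ℝ → E} {x : X → ℝ} (hf : Continuous f.uncurry) (hx : Continuous x) :
    Continuous fun z => PI1DTerm a b i (x z) (f z) := by
  unfold PI1DTerm
  refine continuous_evalAddIntegral hf hx ?_ ?_ <;> fin_cases i <;> simp <;> fun_prop

theorem integral_eq_add_integral_of_continuous {f : ℝ → E} (hf : Continuous f) (p q r : ℝ) :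
    ∫ s in p..r, f s = (∫ s in p..q, f s) + ∫ s in q..r, f s :=
  (intervalIntegral.integral_add_adjacent_intervals (hf.intervalIntegrable _ _)
    (hf.intervalIntegrable _ _)).symm

theorem exists_PI1DTerm_comp (E : Type*) [NormedAddCommGroup E] [NormedSpace ℝ E]
    [CompleteSpace E] (a b : ℝ) (i k : Fin 3) :
    ∃ (e : Fin 3 → ℝ) (t p q : Fin 3 → ℝ × ℝ → ℝ),
      (∀ r, Continuous (t r)) ∧ (∀ r, Continuous (p r)) ∧ (∀ r, Continuous (q r)) ∧
      ∀ f : ℝ → ℝ → E, Continuous f.uncurry → ∀ x,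
        PI1DTerm a b i x (fun θ => PI1DTerm a b k θ (fun η => f θ η)) =
          ∑ r, PI1DTerm a b r x (fun η =>
            evalAddIntegral (e r) (t r (x, η)) (p r (x, η)) (q r (x, η)) (fun θ => f θ η)) := by
  have swap : ∀ f : ℝ → ℝ → E, Continuous f.uncurry → ∀ p q p' q' : ℝ,
      ∫ θ in p..q, ∫ η in p'..q', f θ η = ∫ η in p'..q', ∫ θ in p..q, f θ η := by
    intro f hf p q p' q'
    simpa [evalAddIntegral] using evalAddIntegral_comm 0 0 p q 0 0 p' q' hf
  have cont : ∀ f : ℝ → ℝ → E, Continuous f.uncurry → ∀ p q : ℝ → ℝ, Continuous p →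
      Continuous q → Continuous fun θ => ∫ η in p θ..q θ, f θ η := by
    intro f hf p q hp hq
    simpa [evalAddIntegral] using
      continuous_evalAddIntegral (e := 0) (t := fun _ => 0) hf continuous_const hp hq
  have c1 : ∀ f : ℝ → ℝ → E, Continuous f.uncurry → ∀ θ, Continuous (f θ) :=
    fun f hf θ => hf.comp (Continuous.prodMk_right θ)
  have c3 : ∀ f : ℝ → ℝ → E, Continuous f.uncurry → Continuous (fun ν θ => f θ ν).uncurry :=
    fun f hf => hf.comp continuous_swap
  by_cases hi : i = 0
  · refine ⟨Pi.single k 1, fun _ z => z.1, fun _ _ => 0, fun _ _ => 0, by fun_prop, by fun_prop,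
      by fun_prop, fun f hf x => ?_⟩
    subst hi
    fin_cases k <;> simp [evalAddIntegral, Fin.sum_univ_three]
  by_cases hk : k = 0
  · refine ⟨Pi.single i 1, fun _ z => z.2, fun _ _ => 0, fun _ _ => 0, by fun_prop, by fun_prop,
      by fun_prop, fun f hf x => ?_⟩
    subst hk
    fin_cases i <;> simp [evalAddIntegral, Fin.sum_univ_three]
  suffices h : ∃ p₁ q₁ p₂ q₂ : ℝ × ℝ → ℝ,
      Continuous p₁ ∧ Continuous q₁ ∧ Continuous p₂ ∧ Continuous q₂ ∧
      ∀ f : ℝ → ℝ → E, Continuous f.uncurry → ∀ x,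
        PI1DTerm a b i x (fun θ => PI1DTerm a b k θ (fun η => f θ η)) =
          (∫ η in a..x, ∫ θ in p₁ (x, η)..q₁ (x, η), f θ η)
          + ∫ η in x..b, ∫ θ in p₂ (x, η)..q₂ (x, η), f θ η by
    obtain ⟨p₁, q₁, p₂, q₂, hp₁, hq₁, hp₂, hq₂, h⟩ := h
    refine ⟨fun _ => 0, fun _ _ => 0, ![fun _ => 0, p₁, p₂], ![fun _ => 0, q₁, q₂],
      by fun_prop, fun r => ?_, fun r => ?_, fun f hf x => ?_⟩
    · fin_cases r
      exacts [continuous_const, hp₁, hp₂]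
    · fin_cases r
      exacts [continuous_const, hq₁, hq₂]
    · rw [h f hf x]
      simp [evalAddIntegral, Fin.sum_univ_three]
  fin_cases i <;> fin_cases k <;> simp at hi hk
  · refine ⟨fun z => z.2, fun z => z.1, fun _ => 0, fun _ => 0, by fun_prop, by fun_prop,
      by fun_prop, by fun_prop, fun f hf x => ?_⟩
    simpa using intervalIntegral_triangle_swap_s1 hf a x
  · refine ⟨fun _ => a, fun z => z.2, fun _ => a, fun z => z.1, by fun_prop, by fun_prop,
      by fun_prop, by fun_prop, fun f hf x => ?_⟩
    have h := intervalIntegral_triangle_swap_s1 (c3 f hf) a x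
    simp only [Fin.mk_one, Fin.reduceFinMk, PI1DTerm_one, PI1DTerm_two]
    rw [funext fun θ => integral_eq_add_integral_of_continuous (c1 f hf θ) θ x b,
      ← swap f hf a x x b, intervalIntegral.integral_add, h]
    · exact (cont f hf _ _ continuous_id continuous_const).intervalIntegrable _ _
    · exact (cont f hf _ _ continuous_const continuous_const).intervalIntegrable _ _
  · refine ⟨fun z => z.1, fun _ => b, fun z => z.2, fun _ => b, by fun_prop, by fun_prop,
      by fun_prop, by fun_prop, fun f hf x => ?_⟩
    have h := intervalIntegral_triangle_swap_s1 hf x b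
    simp only [Fin.mk_one, Fin.reduceFinMk, PI1DTerm_one, PI1DTerm_two]
    rw [funext fun θ => integral_eq_add_integral_of_continuous (c1 f hf θ) a x θ,
      ← swap f hf x b a x, intervalIntegral.integral_add, h]
    · exact (cont f hf _ _ continuous_const continuous_const).intervalIntegrable _ _
    · exact (cont f hf _ _ continuous_const continuous_id).intervalIntegrable _ _
  · refine ⟨fun _ => 0, fun _ => 0, fun z => z.1, fun z => z.2, by fun_prop, by fun_prop,
      by fun_prop, by fun_prop, fun f hf x => ?_⟩
    simpa using (intervalIntegral_triangle_swap_s1 (c3 f hf) x b).symm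

variable {U V W : Type*} [NormedAddCommGroup U] [NormedSpace ℝ U] [CompleteSpace U]
  [NormedAddCommGroup V] [NormedSpace ℝ V] [CompleteSpace V]
  [NormedAddCommGroup W] [NormedSpace ℝ W] [CompleteSpace W]

theorem PI1DTerm_sum {ι : Type*} [Fintype ι] (a b : ℝ) (i : Fin 3) (x : ℝ) {f : ι → ℝ → E}
    (hf : ∀ i, Continuous (f i)) :
    PI1DTerm a b i x (fun s => ∑ j, f j s) = ∑ j, PI1DTerm a b i x (f j) :=
  evalAddIntegral_sum _ _ _ _ hf

theorem ContinuousLinearMap.map_PI1DTerm (L : U →L[ℝ] V) (a b : ℝ) (i : Fin 3) (x : ℝ)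
    {f : ℝ → U} (hf : Continuous f) :
    L (PI1DTerm a b i x f) = PI1DTerm a b i x (fun s => L (f s)) :=
  L.map_evalAddIntegral _ _ _ _ hf

theorem evalAddIntegral_PI1DTerm_comm [CompleteSpace E] (e t p q a b : ℝ) (i : Fin 3) (x : ℝ)
    {f : ℝ → ℝ → E} (hf : Continuous f.uncurry) :
    evalAddIntegral e t p q (fun θ => PI1DTerm a b i x (fun ν => f θ ν)) =
      PI1DTerm a b i x (fun ν => evalAddIntegral e t p q (fun θ => f θ ν)) :=
  evalAddIntegral_comm _ _ _ _ _ _ _ _ hf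

theorem PI1DTerm_comm [CompleteSpace E] (a b : ℝ) (i : Fin 3) (x : ℝ) (c d : ℝ) (j : Fin 3)
    (y : ℝ) {f : ℝ → ℝ → E} (hf : Continuous f.uncurry) :
    PI1DTerm a b i x (fun θ => PI1DTerm c d j y (fun ν => f θ ν)) =
      PI1DTerm c d j y (fun ν => PI1DTerm a b i x (fun θ => f θ ν)) :=
  evalAddIntegral_comm _ _ _ _ _ _ _ _ hf

theorem exists_kernel_comp_term (a b c d : ℝ) (i j k l : Fin 3)
    {K : ℝ × ℝ × ℝ × ℝ → V →L[ℝ] W} (hK : Continuous K)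
    {L : ℝ × ℝ × ℝ × ℝ → U →L[ℝ] V} (hL : Continuous L) :
    ∃ Q : Fin 3 → Fin 3 → ℝ × ℝ × ℝ × ℝ → U →L[ℝ] W, (∀ r s, Continuous (Q r s)) ∧
      ∀ u : ℝ × ℝ → U, Continuous u → ∀ x y,
        PI1DTerm a b i x (fun θ => PI1DTerm c d j y (fun ν => K (x, y, θ, ν)
          (PI1DTerm a b k θ (fun η => PI1DTerm c d l ν (fun ζ =>
            L (θ, ν, η, ζ) (u (η, ζ))))))) =
        ∑ r, ∑ s, PI1DTerm a b r x (fun η => PI1DTerm c d s y (fun ζ =>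
          Q r s (x, y, η, ζ) (u (η, ζ)))) := by
  obtain ⟨e, t, p, q, ht, hp, hq, h⟩ := exists_PI1DTerm_comp W a b i k
  obtain ⟨e', t', p', q', ht', hp', hq', h'⟩ := exists_PI1DTerm_comp W c d j l
  refine ⟨fun r s z => evalAddIntegral (e r) (t r (z.1, z.2.2.1)) (p r (z.1, z.2.2.1))
    (q r (z.1, z.2.2.1)) (fun θ => evalAddIntegral (e' s) (t' s (z.2.1, z.2.2.2))
      (p' s (z.2.1, z.2.2.2)) (q' s (z.2.1, z.2.2.2)) (fun ν =>
        (K (z.1, z.2.1, θ, ν)).comp (L (θ, ν, z.2.2.1, z.2.2.2)))), fun r s => ?_,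
    fun u hu x y => ?_⟩
  · fun_prop
  calc
    _ = PI1DTerm a b i x (fun θ => PI1DTerm a b k θ (fun η => PI1DTerm c d j y (fun ν =>
          PI1DTerm c d l ν (fun ζ => K (x, y, θ, ν) (L (θ, ν, η, ζ) (u (η, ζ))))))) := by
      refine congrArg _ (funext fun θ => ?_)
      rw [PI1DTerm_comm _ _ _ _ _ _ _ _ (by fun_prop)]
      refine congrArg _ (funext fun ν => ?_)
      rw [ContinuousLinearMap.map_PI1DTerm _ _ _ _ _ (by fun_prop)]
      refine congrArg _ (funext fun η => ?_)
      rw [ContinuousLinearMap.map_PI1DTerm _ _ _ _ _ (by fun_prop)]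
    _ = PI1DTerm a b i x (fun θ => PI1DTerm a b k θ (fun η => ∑ s, PI1DTerm c d s y (fun ζ =>
          evalAddIntegral (e' s) (t' s (y, ζ)) (p' s (y, ζ)) (q' s (y, ζ)) (fun ν =>
            K (x, y, θ, ν) (L (θ, ν, η, ζ) (u (η, ζ))))))) := by
      refine congrArg _ (funext fun θ => congrArg _ (funext fun η => ?_))
      rw [h' _ (by fun_prop)]
    _ = ∑ r, PI1DTerm a b r x (fun η => evalAddIntegral (e r) (t r (x, η)) (p r (x, η))
          (q r (x, η)) (fun θ => ∑ s, PI1DTerm c d s y (fun ζ =>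
            evalAddIntegral (e' s) (t' s (y, ζ)) (p' s (y, ζ)) (q' s (y, ζ)) (fun ν =>
              K (x, y, θ, ν) (L (θ, ν, η, ζ) (u (η, ζ))))))) := by
      rw [h _ (by fun_prop)]
    _ = _ := by
      refine Finset.sum_congr rfl fun r _ => ?_
      rw [← PI1DTerm_sum _ _ _ _ (fun s => by fun_prop)]
      refine congrArg _ (funext fun η => ?_)
      rw [evalAddIntegral_sum _ _ _ _ (fun s => by fun_prop)]
      refine Finset.sum_congr rfl fun s _ => ?_
      rw [evalAddIntegral_PI1DTerm_comm _ _ _ _ _ _ _ _ (by fun_prop)]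
      refine congrArg _ (funext fun ζ => ?_)
      rw [evalAddIntegral_apply _ _ _ _ (by fun_prop)]
      refine congrArg _ (funext fun θ => ?_)
      rw [evalAddIntegral_apply _ _ _ _ (by fun_prop)]
      rfl

/-- The 2D-PI operator with kernels `K i j` paired with the terms `i` in `x` and `j` in `y`. -/
def PI2DSum (a b c d : ℝ) (K : Fin 3 → Fin 3 → ℝ × ℝ × ℝ × ℝ → U →L[ℝ] V) (u : ℝ × ℝ → U)
    (z : ℝ × ℝ) : V :=
  ∑ i, ∑ j, PI1DTerm a b i z.1 (fun θ => PI1DTerm c d j z.2 (fun ν =>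
    K i j (z.1, z.2, θ, ν) (u (θ, ν))))

theorem PI1DTerm_PI1DTerm_sum {ι : Type*} [Fintype ι] (a b : ℝ) (i : Fin 3) (x : ℝ) (c d : ℝ)
    (j : Fin 3) (y : ℝ) {f : ι → ℝ → ℝ → E} (hf : ∀ k, Continuous (f k).uncurry) :
    PI1DTerm a b i x (fun θ => PI1DTerm c d j y (fun ν => ∑ k, f k θ ν)) =
      ∑ k, PI1DTerm a b i x (fun θ => PI1DTerm c d j y (fun ν => f k θ ν)) := by
  rw [← PI1DTerm_sum _ _ _ _ fun k => by fun_prop]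
  refine congrArg _ (funext fun θ => ?_)
  rw [← PI1DTerm_sum _ _ _ _ fun k => by fun_prop]

theorem exists_PI2DSum_comp (a b c d : ℝ)
    {K : Fin 3 → Fin 3 → ℝ × ℝ × ℝ × ℝ → V →L[ℝ] W} (hK : ∀ i j, Continuous (K i j))
    {L : Fin 3 → Fin 3 → ℝ × ℝ × ℝ × ℝ → U →L[ℝ] V} (hL : ∀ i j, Continuous (L i j)) :
    ∃ Q : Fin 3 → Fin 3 → ℝ × ℝ × ℝ × ℝ → U →L[ℝ] W, (∀ r s, Continuous (Q r s)) ∧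
      ∀ u : ℝ × ℝ → U, Continuous u → ∀ z,
        PI2DSum a b c d K (PI2DSum a b c d L u) z = PI2DSum a b c d Q u z := by
  choose Q hQ h using fun w : Fin 3 × Fin 3 × Fin 3 × Fin 3 =>
    exists_kernel_comp_term a b c d w.1 w.2.1 w.2.2.1 w.2.2.2 (hK w.1 w.2.1) (hL w.2.2.1 w.2.2.2)
  refine ⟨fun r s z => ∑ w, Q w r s z, fun r s => by fun_prop, fun u hu z => ?_⟩
  calc
    _ = ∑ w, ∑ r, ∑ s, PI1DTerm a b r z.1 (fun η => PI1DTerm c d s z.2 (fun ζ =>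
          Q w r s (z.1, z.2, η, ζ) (u (η, ζ)))) := by
      simp_rw [← h _ u hu, Fintype.sum_prod_type]
      refine Finset.sum_congr rfl fun i _ => Finset.sum_congr rfl fun j _ => ?_
      simp_rw [PI2DSum, map_sum]
      rw [PI1DTerm_PI1DTerm_sum _ _ _ _ _ _ _ _ fun k => by fun_prop]
      refine Finset.sum_congr rfl fun k _ => ?_
      rw [PI1DTerm_PI1DTerm_sum _ _ _ _ _ _ _ _ fun l => by fun_prop]
    _ = _ := by
      rw [Finset.sum_comm]
      refine Finset.sum_congr rfl fun r _ => ?_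
      rw [Finset.sum_comm]
      refine Finset.sum_congr rfl fun s _ => ?_
      rw [← PI1DTerm_PI1DTerm_sum _ _ _ _ _ _ _ _ fun w => by fun_prop]
      simp only [_root_.sum_apply]

end

theorem max_min_eq_of_mem_Icc {a b x : ℝ} (hx : x ∈ Icc a b) : max a (min b x) = x := by
  rw [min_eq_right hx.2, max_eq_right hx.1]

theorem max_min_mem_Icc {a b : ℝ} (hab : a ≤ b) (x : ℝ) : max a (min b x) ∈ Icc a b :=
  ⟨le_max_left _ _, max_le hab (min_le_left _ _)⟩

theorem PI2D_congr {p r : ℕ} {a b c d : ℝ} {N N' : PI2DK p r} {u u' : ℝ → ℝ → Fin r → ℝ}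
    {x y : ℝ} (hx : x ∈ Icc a b) (hy : y ∈ Icc c d)
    (h00 : N.k00 x y = N'.k00 x y)
    (h10 : ∀ θ ∈ Icc a b, N.k10 x y θ = N'.k10 x y θ)
    (h20 : ∀ θ ∈ Icc a b, N.k20 x y θ = N'.k20 x y θ)
    (h01 : ∀ ν ∈ Icc c d, N.k01 x y ν = N'.k01 x y ν)
    (h02 : ∀ ν ∈ Icc c d, N.k02 x y ν = N'.k02 x y ν)
    (h11 : ∀ θ ∈ Icc a b, ∀ ν ∈ Icc c d, N.k11 x y θ ν = N'.k11 x y θ ν)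
    (h21 : ∀ θ ∈ Icc a b, ∀ ν ∈ Icc c d, N.k21 x y θ ν = N'.k21 x y θ ν)
    (h12 : ∀ θ ∈ Icc a b, ∀ ν ∈ Icc c d, N.k12 x y θ ν = N'.k12 x y θ ν)
    (h22 : ∀ θ ∈ Icc a b, ∀ ν ∈ Icc c d, N.k22 x y θ ν = N'.k22 x y θ ν)
    (hu : ∀ θ ∈ Icc a b, ∀ ν ∈ Icc c d, u θ ν = u' θ ν) :
    PI2D a b c d N u x y = PI2D a b c d N' u' x y := by
  have lower {s t z w : ℝ} (hz : z ∈ Icc s t) (hw : w ∈ uIcc s z) : w ∈ Icc s t := by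
    rw [uIcc_of_le hz.1] at hw
    exact ⟨hw.1, hw.2.trans hz.2⟩
  have upper {s t z w : ℝ} (hz : z ∈ Icc s t) (hw : w ∈ uIcc z t) : w ∈ Icc s t := by
    rw [uIcc_of_le hz.2] at hw
    exact ⟨hz.1.trans hw.1, hw.2⟩
  have cong {s t : ℝ} {f g : ℝ → Fin p → ℝ} (h : ∀ w ∈ uIcc s t, f w = g w) :
      ∫ w in s..t, f w = ∫ w in s..t, g w := intervalIntegral.integral_congr h
  unfold PI2D
  iterate 8 refine congrArg₂ HAdd.hAdd ?_ ?_
  · rw [h00, hu x hx y hy]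
  · exact cong fun θ hθ => by rw [h10 θ (lower hx hθ), hu θ (lower hx hθ) y hy]
  · exact cong fun θ hθ => by rw [h20 θ (upper hx hθ), hu θ (upper hx hθ) y hy]
  · exact cong fun ν hν => by rw [h01 ν (lower hy hν), hu x hx ν (lower hy hν)]
  · exact cong fun ν hν => by rw [h02 ν (upper hy hν), hu x hx ν (upper hy hν)]
  · exact cong fun θ hθ => cong fun ν hν => by
      rw [h11 θ (lower hx hθ) ν (lower hy hν), hu θ (lower hx hθ) ν (lower hy hν)]
  · exact cong fun θ hθ => cong fun ν hν => by
      rw [h21 θ (upper hx hθ) ν (lower hy hν), hu θ (upper hx hθ) ν (lower hy hν)]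
  · exact cong fun θ hθ => cong fun ν hν => by
      rw [h12 θ (lower hx hθ) ν (upper hy hν), hu θ (lower hx hθ) ν (upper hy hν)]
  · exact cong fun θ hθ => cong fun ν hν => by
      rw [h22 θ (upper hx hθ) ν (upper hy hν), hu θ (upper hx hθ) ν (upper hy hν)]

/-- Matrices as continuous linear maps between function spaces. -/
def matrixCLM (p r : ℕ) :
    Matrix (Fin p) (Fin r) ℝ ≃ₗ[ℝ] ((Fin r → ℝ) →L[ℝ] (Fin p → ℝ)) :=
  Matrix.toLin'.trans LinearMap.toContinuousLinearMap

@[simp] theorem matrixCLM_apply {p r : ℕ} (A : Matrix (Fin p) (Fin r) ℝ) (v : Fin r → ℝ) :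
    matrixCLM p r A v = A *ᵥ v := rfl

@[simp] theorem matrixCLM_symm_mulVec {p r : ℕ} (L : (Fin r → ℝ) →L[ℝ] (Fin p → ℝ))
    (v : Fin r → ℝ) : (matrixCLM p r).symm L *ᵥ v = L v := by
  rw [← matrixCLM_apply, LinearEquiv.apply_symm_apply]

@[fun_prop]
theorem continuous_matrixCLM (p r : ℕ) : Continuous (matrixCLM p r) :=
  (matrixCLM p r).toLinearMap.continuous_of_finiteDimensional

@[fun_prop]
theorem continuous_matrixCLM_symm (p r : ℕ) : Continuous (matrixCLM p r).symm :=
  (matrixCLM p r).symm.toLinearMap.continuous_of_finiteDimensional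

/-- The kernels of `N`, extended from `[a,b] × [c,d]` to the plane by projecting each variable
onto its interval, as continuous linear maps. -/
def PI2DK.toCLM {p r : ℕ} (a b c d : ℝ) (N : PI2DK p r) (i j : Fin 3) (z : ℝ × ℝ × ℝ × ℝ) :
    (Fin r → ℝ) →L[ℝ] (Fin p → ℝ) :=
  let x := max a (min b z.1)
  let y := max c (min d z.2.1)
  let θ := max a (min b z.2.2.1)
  let ν := max c (min d z.2.2.2)
  matrixCLM p r <|
    ![![N.k00 x y, N.k01 x y ν, N.k02 x y ν],
      ![N.k10 x y θ, N.k11 x y θ ν, N.k12 x y θ ν],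
      ![N.k20 x y θ, N.k21 x y θ ν, N.k22 x y θ ν]] i j

/-- The family of 2D-PI kernels with prescribed continuous linear maps. -/
def PI2DK.ofCLM {p r : ℕ} (K : Fin 3 → Fin 3 → ℝ × ℝ × ℝ × ℝ → (Fin r → ℝ) →L[ℝ] (Fin p → ℝ)) :
    PI2DK p r where
  k00 x y := (matrixCLM p r).symm (K 0 0 (x, y, x, y))
  k10 x y θ := (matrixCLM p r).symm (K 1 0 (x, y, θ, y))
  k20 x y θ := (matrixCLM p r).symm (K 2 0 (x, y, θ, y))
  k01 x y ν := (matrixCLM p r).symm (K 0 1 (x, y, x, ν))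
  k02 x y ν := (matrixCLM p r).symm (K 0 2 (x, y, x, ν))
  k11 x y θ ν := (matrixCLM p r).symm (K 1 1 (x, y, θ, ν))
  k21 x y θ ν := (matrixCLM p r).symm (K 2 1 (x, y, θ, ν))
  k12 x y θ ν := (matrixCLM p r).symm (K 1 2 (x, y, θ, ν))
  k22 x y θ ν := (matrixCLM p r).symm (K 2 2 (x, y, θ, ν))

theorem PI2DK.isCont_ofCLM {p r : ℕ} (a b c d : ℝ)
    {K : Fin 3 → Fin 3 → ℝ × ℝ × ℝ × ℝ → (Fin r → ℝ) →L[ℝ] (Fin p → ℝ)}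
    (hK : ∀ i j, Continuous (K i j)) : (PI2DK.ofCLM K).IsCont a b c d := by
  refine ⟨?_, ?_, ?_, ?_, ?_, ?_, ?_, ?_, ?_⟩ <;>
    exact Continuous.continuousOn (by simp only [ofCLM]; fun_prop)

theorem PI2DK.IsCont.continuous_toCLM {p r : ℕ} {a b c d : ℝ} (hab : a ≤ b) (hcd : c ≤ d)
    {N : PI2DK p r} (hN : N.IsCont a b c d) (i j : Fin 3) : Continuous (N.toCLM a b c d i j) := by
  obtain ⟨h00, h10, h20, h01, h02, h11, h21, h12, h22⟩ := hN
  have hx := max_min_mem_Icc hab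
  have hy := max_min_mem_Icc hcd
  refine (continuous_matrixCLM p r).comp ?_
  fin_cases i <;> fin_cases j
  · exact h00.comp_continuous (f := fun z : ℝ × ℝ × ℝ × ℝ =>
      (max a (min b z.1), max c (min d z.2.1))) (by fun_prop) fun z => ⟨hx _, hy _⟩
  · exact h01.comp_continuous (f := fun z : ℝ × ℝ × ℝ × ℝ =>
      (max a (min b z.1), max c (min d z.2.1), max c (min d z.2.2.2)))
      (by fun_prop) fun z => ⟨hx _, hy _, hy _⟩
  · exact h02.comp_continuous (f := fun z : ℝ × ℝ × ℝ × ℝ =>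
      (max a (min b z.1), max c (min d z.2.1), max c (min d z.2.2.2)))
      (by fun_prop) fun z => ⟨hx _, hy _, hy _⟩
  · exact h10.comp_continuous (f := fun z : ℝ × ℝ × ℝ × ℝ =>
      (max a (min b z.1), max c (min d z.2.1), max a (min b z.2.2.1)))
      (by fun_prop) fun z => ⟨hx _, hy _, hx _⟩
  rotate_left 2
  · exact h20.comp_continuous (f := fun z : ℝ × ℝ × ℝ × ℝ =>
      (max a (min b z.1), max c (min d z.2.1), max a (min b z.2.2.1)))
      (by fun_prop) fun z => ⟨hx _, hy _, hx _⟩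
  rotate_left 2
  all_goals
    have hc : Continuous fun z : ℝ × ℝ × ℝ × ℝ =>
      (max a (min b z.1), max c (min d z.2.1), max a (min b z.2.2.1),
        max c (min d z.2.2.2)) := by fun_prop
    have hm : ∀ z : ℝ × ℝ × ℝ × ℝ,
      (max a (min b z.1), max c (min d z.2.1), max a (min b z.2.2.1), max c (min d z.2.2.2)) ∈
        Icc a b ×ˢ Icc c d ×ˢ Icc a b ×ˢ Icc c d := fun z => ⟨hx _, hy _, hx _, hy _⟩
  exacts [h11.comp_continuous hc hm, h12.comp_continuous hc hm, h21.comp_continuous hc hm,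
    h22.comp_continuous hc hm]

theorem PI2D_ofCLM {p r : ℕ} (a b c d : ℝ)
    (K : Fin 3 → Fin 3 → ℝ × ℝ × ℝ × ℝ → (Fin r → ℝ) →L[ℝ] (Fin p → ℝ))
    (u : ℝ × ℝ → Fin r → ℝ) (x y : ℝ) :
    PI2D a b c d (PI2DK.ofCLM K) (fun x y => u (x, y)) x y = PI2DSum a b c d K u (x, y) := by
  simp only [PI2D, PI2DK.ofCLM, PI2DSum, Fin.sum_univ_three, PI1DTerm_zero, PI1DTerm_one,
    PI1DTerm_two, matrixCLM_symm_mulVec]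
  abel

theorem PI2D_eq_PI2DSum {p r : ℕ} {a b c d : ℝ} (N : PI2DK p r) {u : ℝ → ℝ → Fin r → ℝ}
    {v : ℝ × ℝ → Fin r → ℝ} (huv : ∀ θ ∈ Icc a b, ∀ ν ∈ Icc c d, u θ ν = v (θ, ν))
    {x y : ℝ} (hx : x ∈ Icc a b) (hy : y ∈ Icc c d) :
    PI2D a b c d N u x y = PI2DSum a b c d (N.toCLM a b c d) v (x, y) := by
  rw [← PI2D_ofCLM]
  refine PI2D_congr hx hy ?_ (fun θ hθ => ?_) (fun θ hθ => ?_) (fun ν hν => ?_) (fun ν hν => ?_)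
    (fun θ hθ ν hν => ?_) (fun θ hθ ν hν => ?_) (fun θ hθ ν hν => ?_) (fun θ hθ ν hν => ?_) huv
  all_goals
    clear huv
    simp only [PI2DK.ofCLM, PI2DK.toCLM, max_min_eq_of_mem_Icc, *]
    exact ((matrixCLM p r).symm_apply_apply _).symm

/-- 2D-PI operators are closed under composition. -/
theorem composition_of_2D_PI_operators {n p m : ℕ} (a b c d : ℝ)
    (hab : a < b) (hcd : c < d)
    (N : PI2DK n p) (M : PI2DK p m)
    (hN : N.IsCont a b c d) (hM : M.IsCont a b c d) :
    ∃ Q : PI2DK n m, Q.IsCont a b c d ∧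
      ∀ u : ℝ → ℝ → Fin m → ℝ,
        ContinuousOn (fun q : ℝ × ℝ => u q.1 q.2) (Icc a b ×ˢ Icc c d) →
        ∀ x ∈ Icc a b, ∀ y ∈ Icc c d,
          PI2D a b c d N (PI2D a b c d M u) x y = PI2D a b c d Q u x y := by
  obtain ⟨Q, hQ, h⟩ := exists_PI2DSum_comp a b c d
    (hN.continuous_toCLM hab.le hcd.le) (hM.continuous_toCLM hab.le hcd.le)
  refine ⟨PI2DK.ofCLM Q, PI2DK.isCont_ofCLM a b c d hQ, fun u hu x hx y hy => ?_⟩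
  obtain ⟨v, hv, huv⟩ : ∃ v : ℝ × ℝ → Fin m → ℝ, Continuous v ∧
      ∀ θ ∈ Icc a b, ∀ ν ∈ Icc c d, u θ ν = v (θ, ν) :=
    ⟨fun z => u (max a (min b z.1)) (max c (min d z.2)),
      hu.comp_continuous (f := fun z : ℝ × ℝ => (max a (min b z.1), max c (min d z.2)))
        (by fun_prop) fun z => ⟨max_min_mem_Icc hab.le _, max_min_mem_Icc hcd.le _⟩,
      fun θ hθ ν hν => by simp only [max_min_eq_of_mem_Icc hθ, max_min_eq_of_mem_Icc hν]⟩
  rw [PI2D_eq_PI2DSum N (fun θ hθ ν hν => PI2D_eq_PI2DSum M huv hθ hν) hx hy, h v hv,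
    ← PI2D_ofCLM]
  exact PI2D_congr hx hy rfl (fun _ _ => rfl) (fun _ _ => rfl) (fun _ _ => rfl) (fun _ _ => rfl)
    (fun _ _ _ _ => rfl) (fun _ _ _ _ => rfl) (fun _ _ _ _ => rfl) (fun _ _ _ _ => rfl)
    fun θ hθ ν hν => (huv θ hθ ν hν).symm ▸ rfl
end
end

section
/- Let N be a family of 2D-PI kernels of size n×p and M a family of 2D-PI kernels of size p×m, and suppose that every entry of every one of the nine kernels of N and of M is a polynomial function of its arguments (i.e., the restriction to its domain of the evaluation of a real multivariate polynomial). Then there exists a family Q of 2D-PI kernels of size n×m, every entry of every kernel of which is again a polynomial function of its arguments, such that for every continuous u : [a,b]×[c,d] → ℝ^m and every (x,y) ∈ [a,b]×[c,d], (P[N](P[M]u))(x,y) = (P[Q]u)(x,y). -/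
open Matrix MeasureTheory Set

noncomputable section

/-- A function of two real variables is polynomial on `s1 × s2`. -/
def PolyOn2 (s1 s2 : Set ℝ) (f : ℝ → ℝ → ℝ) : Prop :=
  ∃ P : MvPolynomial (Fin 2) ℝ, ∀ x ∈ s1, ∀ y ∈ s2,
    f x y = MvPolynomial.eval ![x, y] P

/-- A function of three real variables is polynomial on `s1 × s2 × s3`. -/
def PolyOn3 (s1 s2 s3 : Set ℝ) (f : ℝ → ℝ → ℝ → ℝ) : Prop :=
  ∃ P : MvPolynomial (Fin 3) ℝ, ∀ x ∈ s1, ∀ y ∈ s2, ∀ z ∈ s3,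
    f x y z = MvPolynomial.eval ![x, y, z] P

/-- A function of four real variables is polynomial on `s1 × s2 × s3 × s4`. -/
def PolyOn4 (s1 s2 s3 s4 : Set ℝ) (f : ℝ → ℝ → ℝ → ℝ → ℝ) : Prop :=
  ∃ P : MvPolynomial (Fin 4) ℝ, ∀ x ∈ s1, ∀ y ∈ s2, ∀ z ∈ s3, ∀ w ∈ s4,
    f x y z w = MvPolynomial.eval ![x, y, z, w] P

/-- Every entry of every kernel of a family of 2D-PI kernels is polynomial on its domain. -/
def PI2DK.IsPoly {p r : ℕ} (a b c d : ℝ) (N : PI2DK p r) : Prop :=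
  (∀ i j, PolyOn2 (Icc a b) (Icc c d) fun x y => N.k00 x y i j) ∧
  (∀ i j, PolyOn3 (Icc a b) (Icc c d) (Icc a b) fun x y θ => N.k10 x y θ i j) ∧
  (∀ i j, PolyOn3 (Icc a b) (Icc c d) (Icc a b) fun x y θ => N.k20 x y θ i j) ∧
  (∀ i j, PolyOn3 (Icc a b) (Icc c d) (Icc c d) fun x y ν => N.k01 x y ν i j) ∧
  (∀ i j, PolyOn3 (Icc a b) (Icc c d) (Icc c d) fun x y ν => N.k02 x y ν i j) ∧
  (∀ i j, PolyOn4 (Icc a b) (Icc c d) (Icc a b) (Icc c d)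
      fun x y θ ν => N.k11 x y θ ν i j) ∧
  (∀ i j, PolyOn4 (Icc a b) (Icc c d) (Icc a b) (Icc c d)
      fun x y θ ν => N.k21 x y θ ν i j) ∧
  (∀ i j, PolyOn4 (Icc a b) (Icc c d) (Icc a b) (Icc c d)
      fun x y θ ν => N.k12 x y θ ν i j) ∧
  (∀ i j, PolyOn4 (Icc a b) (Icc c d) (Icc a b) (Icc c d)
      fun x y θ ν => N.k22 x y θ ν i j)

/-! ### An algebra of two-sided words -/

section Words

variable {A : Type*} [Ring A] [Algebra ℝ A]

/-- The span of the words `X ^ i * g s * X ^ k`. -/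
def wordSpan (X : A) (g : Fin 3 → A) : Submodule ℝ A :=
  Submodule.span ℝ (range fun q : ℕ × ℕ × Fin 3 => X ^ q.1 * g q.2.2 * X ^ q.2.1)

/-- The identity together with the two one-sided integrals, expressed through the
integration operators `I` and `J` based at the two end points of the interval. -/
def modes (I J : A) : Fin 3 → A := ![1, I, -J]

theorem word_mem (X : A) (g : Fin 3 → A) (i k : ℕ) (s : Fin 3) :
    X ^ i * g s * X ^ k ∈ wordSpan X g :=
  Submodule.subset_span ⟨(i, k, s), rfl⟩

theorem pow_mul_mul_pow_mem_wordSpan {X : A} {g : Fin 3 → A} (i k : ℕ) {T : A}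
    (hT : T ∈ wordSpan X g) : X ^ i * T * X ^ k ∈ wordSpan X g := by
  induction hT using Submodule.span_induction with
  | mem T h =>
    obtain ⟨⟨i', k', s⟩, rfl⟩ := h
    have := word_mem X g (i + i') (k' + k) s
    simpa only [pow_add, mul_assoc] using this
  | zero => simp
  | add S T _ _ hS hT => simpa only [mul_add, add_mul] using add_mem hS hT
  | smul r T _ hT =>
    simpa only [mul_smul_comm, smul_mul_assoc] using Submodule.smul_mem _ r hT

theorem wordSpan_mul_le {X : A} {g : Fin 3 → A}
    (h : ∀ s t n, g s * X ^ n * g t ∈ wordSpan X g) :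
    wordSpan X g * wordSpan X g ≤ wordSpan X g := by
  conv_lhs => rw [wordSpan, Submodule.span_mul_span]
  rw [Submodule.span_le]
  rintro _ ⟨_, ⟨⟨i, k, s⟩, rfl⟩, _, ⟨⟨i', k', t⟩, rfl⟩, rfl⟩
  have := pow_mul_mul_pow_mem_wordSpan i k' (h s t (k + i'))
  simpa only [pow_add, mul_assoc, SetLike.mem_coe] using this

theorem modes_mul_pow_mul_modes_mem {X I J : A} {a b : ℝ}
    (hII : ∀ n : ℕ, I * X ^ n * I = ((n : ℝ) + 1)⁻¹ •
      (X ^ (n + 1) * I - I * X ^ (n + 1) + a ^ (n + 1) • (I - I)))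
    (hIJ : ∀ n : ℕ, I * X ^ n * J = ((n : ℝ) + 1)⁻¹ •
      (X ^ (n + 1) * J - I * X ^ (n + 1) + a ^ (n + 1) • (I - J)))
    (hJI : ∀ n : ℕ, J * X ^ n * I = ((n : ℝ) + 1)⁻¹ •
      (X ^ (n + 1) * I - J * X ^ (n + 1) + b ^ (n + 1) • (J - I)))
    (hJJ : ∀ n : ℕ, J * X ^ n * J = ((n : ℝ) + 1)⁻¹ •
      (X ^ (n + 1) * J - J * X ^ (n + 1) + b ^ (n + 1) • (J - J)))
    (s t : Fin 3) (n : ℕ) :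
    modes I J s * X ^ n * modes I J t ∈ wordSpan X (modes I J) := by
  have hI : ∀ i k, X ^ i * I * X ^ k ∈ wordSpan X (modes I J) := fun i k =>
    word_mem X (modes I J) i k 1
  have hJ : ∀ i k, X ^ i * J * X ^ k ∈ wordSpan X (modes I J) := fun i k => by
    simpa [modes] using neg_mem (word_mem X (modes I J) i k 2)
  have hI0 : I ∈ wordSpan X (modes I J) := by simpa using hI 0 0
  have hJ0 : J ∈ wordSpan X (modes I J) := by simpa using hJ 0 0
  have hIl : ∀ i, X ^ i * I ∈ wordSpan X (modes I J) := fun i => by simpa using hI i 0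
  have hIr : ∀ k, I * X ^ k ∈ wordSpan X (modes I J) := fun k => by simpa using hI 0 k
  have hJl : ∀ i, X ^ i * J ∈ wordSpan X (modes I J) := fun i => by simpa using hJ i 0
  have hJr : ∀ k, J * X ^ k ∈ wordSpan X (modes I J) := fun k => by simpa using hJ 0 k
  have key : ∀ (r r' : ℝ) {S T U V : A}, S ∈ wordSpan X (modes I J) →
      T ∈ wordSpan X (modes I J) → U ∈ wordSpan X (modes I J) →
      V ∈ wordSpan X (modes I J) →
      r • (S - T + r' • (U - V)) ∈ wordSpan X (modes I J) :=
    fun r r' S T U V hS hT hU hV => Submodule.smul_mem _ _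
      (add_mem (sub_mem hS hT) (Submodule.smul_mem _ _ (sub_mem hU hV)))
  have h1 : modes I J 0 = 1 := rfl
  have h2 : modes I J 1 = I := rfl
  have h3 : modes I J 2 = -J := rfl
  by_cases hs : s = 0
  · subst hs
    simpa [h1] using word_mem X (modes I J) n 0 t
  by_cases ht : t = 0
  · subst ht
    simpa [h1] using word_mem X (modes I J) 0 n s
  obtain rfl | rfl : s = 1 ∨ s = 2 := by omega
  all_goals obtain rfl | rfl : t = 1 ∨ t = 2 := by omega
  · rw [h2, hII]
    exact key _ _ (hIl _) (hIr _) hI0 hI0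
  · rw [h2, h3, mul_neg, hIJ]
    exact neg_mem (key _ _ (hJl _) (hIr _) hI0 hJ0)
  · rw [h2, h3, neg_mul, neg_mul, hJI]
    exact neg_mem (key _ _ (hIl _) (hJr _) hJ0 hI0)
  · rw [h3, mul_neg, neg_mul, neg_mul, neg_neg, hJJ]
    exact key _ _ (hJl _) (hJr _) hJ0 hJ0

theorem wordSpan_mul_comm {X Y : A} {g h : Fin 3 → A} (hXY : Commute X Y)
    (hXh : ∀ t, Commute X (h t)) (hYg : ∀ s, Commute Y (g s))
    (hgh : ∀ s t, Commute (g s) (h t)) :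
    wordSpan Y h * wordSpan X g ≤ wordSpan X g * wordSpan Y h := by
  conv_lhs => rw [wordSpan, wordSpan, Submodule.span_mul_span]
  rw [Submodule.span_le]
  rintro _ ⟨_, ⟨⟨i, k, s⟩, rfl⟩, _, ⟨⟨i', k', t⟩, rfl⟩, rfl⟩
  have hX : ∀ n, Commute (X ^ n) (Y ^ i * h s * Y ^ k) := fun n =>
    (((hXY.pow_pow n i).mul_right ((hXh s).pow_left n)).mul_right (hXY.pow_pow n k))
  have hg : Commute (g t) (Y ^ i * h s * Y ^ k) :=
    ((((hYg t).pow_left i).symm.mul_right (hgh t s)).mul_right ((hYg t).pow_left k).symm)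
  have : Commute (X ^ i' * g t * X ^ k') (Y ^ i * h s * Y ^ k) :=
    ((hX i').mul_left hg).mul_left (hX k')
  change (Y ^ i * h s * Y ^ k) * (X ^ i' * g t * X ^ k') ∈ _
  rw [← this.eq]
  exact Submodule.mul_mem_mul (word_mem X g i' k' t) (word_mem Y h i k s)

end Words

theorem commute_modes {A : Type*} [Ring A] {T I J : A} (hI : Commute T I)
    (hJ : Commute T J) (s : Fin 3) : Commute T (modes I J s) := by
  fin_cases s
  · exact Commute.one_right T
  · exact hI
  · exact hJ.neg_right

/-! ### Integration operators on continuous functions of two variables -/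

/-- Linear endomorphisms of the space of continuous functions on the plane. -/
abbrev PlaneOp : Type := Module.End ℝ C(ℝ × ℝ, ℝ)

theorem continuous_integral_fst (α : ℝ) (u : C(ℝ × ℝ, ℝ)) :
    Continuous fun q : ℝ × ℝ => ∫ θ in α..q.1, u (θ, q.2) :=
  intervalIntegral.continuous_parametric_intervalIntegral_of_continuous (by fun_prop)
    continuous_fst

theorem continuous_integral_snd (α : ℝ) (u : C(ℝ × ℝ, ℝ)) :
    Continuous fun q : ℝ × ℝ => ∫ ν in α..q.2, u (q.1, ν) :=
  intervalIntegral.continuous_parametric_intervalIntegral_of_continuous (by fun_prop)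
    continuous_snd

/-- Multiplication by the first coordinate. -/
def mulFst : PlaneOp where
  toFun u := ⟨fun q => q.1 * u q, by fun_prop⟩
  map_add' u v := by ext q; simp [mul_add]
  map_smul' r u := by ext q; simp; ring

/-- Multiplication by the second coordinate. -/
def mulSnd : PlaneOp where
  toFun u := ⟨fun q => q.2 * u q, by fun_prop⟩
  map_add' u v := by ext q; simp [mul_add]
  map_smul' r u := by ext q; simp; ring

/-- Integration in the first variable with base point `α`. -/
def intFst (α : ℝ) : PlaneOp where
  toFun u := ⟨fun q => ∫ θ in α..q.1, u (θ, q.2), continuous_integral_fst α u⟩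
  map_add' u v := by
    ext q
    exact intervalIntegral.integral_add
      (Continuous.intervalIntegrable (by fun_prop) _ _)
      (Continuous.intervalIntegrable (by fun_prop) _ _)
  map_smul' r u := by
    ext q
    exact intervalIntegral.integral_const_mul _ _

/-- Integration in the second variable with base point `α`. -/
def intSnd (α : ℝ) : PlaneOp where
  toFun u := ⟨fun q => ∫ ν in α..q.2, u (q.1, ν), continuous_integral_snd α u⟩
  map_add' u v := by
    ext q
    exact intervalIntegral.integral_add
      (Continuous.intervalIntegrable (by fun_prop) _ _)
      (Continuous.intervalIntegrable (by fun_prop) _ _)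
  map_smul' r u := by
    ext q
    exact intervalIntegral.integral_const_mul _ _

theorem mulFst_apply (u : C(ℝ × ℝ, ℝ)) (q : ℝ × ℝ) : mulFst u q = q.1 * u q := rfl

theorem mulSnd_apply (u : C(ℝ × ℝ, ℝ)) (q : ℝ × ℝ) : mulSnd u q = q.2 * u q := rfl

theorem intFst_apply (α : ℝ) (u : C(ℝ × ℝ, ℝ)) (q : ℝ × ℝ) :
    intFst α u q = ∫ θ in α..q.1, u (θ, q.2) := rfl

theorem intSnd_apply (α : ℝ) (u : C(ℝ × ℝ, ℝ)) (q : ℝ × ℝ) :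
    intSnd α u q = ∫ ν in α..q.2, u (q.1, ν) := rfl

theorem mulFst_pow_apply (n : ℕ) (u : C(ℝ × ℝ, ℝ)) (q : ℝ × ℝ) :
    (mulFst ^ n) u q = q.1 ^ n * u q := by
  induction n with
  | zero => simp
  | succ n ih => rw [pow_succ', Module.End.mul_apply, mulFst_apply, ih]; ring

theorem mulSnd_pow_apply (n : ℕ) (u : C(ℝ × ℝ, ℝ)) (q : ℝ × ℝ) :
    (mulSnd ^ n) u q = q.2 ^ n * u q := by
  induction n with
  | zero => simp
  | succ n ih => rw [pow_succ', Module.End.mul_apply, mulSnd_apply, ih]; ring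

theorem integral_pow_mul_integral {f : ℝ → ℝ} (hf : Continuous f) (α β x : ℝ) (n : ℕ) :
    ∫ θ in α..x, θ ^ n * ∫ η in β..θ, f η =
      ((n : ℝ) + 1)⁻¹ * (x ^ (n + 1) * (∫ η in β..x, f η)
        - (∫ θ in α..x, θ ^ (n + 1) * f θ)
        + α ^ (n + 1) * ((∫ η in α..x, f η) - ∫ η in β..x, f η)) := by
  have hn : (n : ℝ) + 1 ≠ 0 := by positivity
  have hv : ∀ θ, HasDerivAt (fun θ => ∫ η in β..θ, f η) (f θ) θ := fun θ =>
    (hf.integral_hasStrictDerivAt β θ).hasDerivAt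
  have hvc : Continuous fun θ => ∫ η in β..θ, f η :=
    continuous_iff_continuousAt.2 fun θ => (hv θ).continuousAt
  have hp : ∀ θ : ℝ, HasDerivAt (fun θ => θ ^ (n + 1)) (((n : ℝ) + 1) * θ ^ n) θ := fun θ => by
    simpa using hasDerivAt_pow (n + 1) θ
  have h := intervalIntegral.integral_mul_deriv_eq_deriv_mul (a := α) (b := x)
    (fun θ _ => hp θ) (fun θ _ => hv θ)
    (Continuous.intervalIntegrable (by fun_prop) _ _) (hf.intervalIntegrable _ _)
  have h2 : ∫ θ in α..x, ((n : ℝ) + 1) * θ ^ n * ∫ η in β..θ, f η =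
      ((n : ℝ) + 1) * ∫ θ in α..x, θ ^ n * ∫ η in β..θ, f η := by
    rw [← intervalIntegral.integral_const_mul]
    simp only [mul_assoc]
  have h3 : (∫ η in β..α, f η) + ∫ η in α..x, f η = ∫ η in β..x, f η :=
    intervalIntegral.integral_add_adjacent_intervals (hf.intervalIntegrable _ _)
      (hf.intervalIntegrable _ _)
  rw [h2] at h
  field_simp
  linear_combination h - α ^ (n + 1) * h3

theorem intFst_mul_pow_mul_intFst (α β : ℝ) (n : ℕ) :
    intFst α * mulFst ^ n * intFst β = ((n : ℝ) + 1)⁻¹ •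
      (mulFst ^ (n + 1) * intFst β - intFst α * mulFst ^ (n + 1)
        + α ^ (n + 1) • (intFst α - intFst β)) := by
  ext u q
  have := integral_pow_mul_integral (f := fun θ => u (θ, q.2)) (by fun_prop) α β q.1 n
  simpa [intFst_apply, mulFst_pow_apply, mul_add] using this

theorem intSnd_mul_pow_mul_intSnd (α β : ℝ) (n : ℕ) :
    intSnd α * mulSnd ^ n * intSnd β = ((n : ℝ) + 1)⁻¹ •
      (mulSnd ^ (n + 1) * intSnd β - intSnd α * mulSnd ^ (n + 1)
        + α ^ (n + 1) • (intSnd α - intSnd β)) := by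
  ext u q
  have := integral_pow_mul_integral (f := fun ν => u (q.1, ν)) (by fun_prop) α β q.2 n
  simpa [intSnd_apply, mulSnd_pow_apply, mul_add] using this

theorem commute_mulFst_mulSnd : Commute mulFst mulSnd := by
  ext u q
  simp only [Module.End.mul_apply, mulFst_apply, mulSnd_apply]
  ring

theorem commute_mulFst_intSnd (α : ℝ) : Commute mulFst (intSnd α) := by
  ext u q
  simp [Module.End.mul_apply, mulFst_apply, intSnd_apply]

theorem commute_mulSnd_intFst (α : ℝ) : Commute mulSnd (intFst α) := by
  ext u q
  simp [Module.End.mul_apply, mulSnd_apply, intFst_apply]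

theorem commute_intFst_intSnd (α β : ℝ) : Commute (intFst α) (intSnd β) := by
  ext u q
  simp only [Module.End.mul_apply, intFst_apply, intSnd_apply]
  exact intervalIntegral_intervalIntegral_swap (F := fun θ ν => u (θ, ν))
    ((u.continuous.continuousOn.integrableOn_compact
      (isCompact_uIcc.prod isCompact_uIcc)).mono_set
        (prod_mono uIoc_subset_uIcc uIoc_subset_uIcc))

/-- The algebra generated by multiplications by polynomials and partial integrations. -/
def polyOps (a b c d : ℝ) : Submodule ℝ PlaneOp :=
  wordSpan mulFst (modes (intFst a) (intFst b)) *
    wordSpan mulSnd (modes (intSnd c) (intSnd d))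

theorem mul_mem_polyOps {a b c d : ℝ} {S T : PlaneOp} (hS : S ∈ polyOps a b c d)
    (hT : T ∈ polyOps a b c d) : S * T ∈ polyOps a b c d := by
  set V := wordSpan mulFst (modes (intFst a) (intFst b)) with hV
  set W := wordSpan mulSnd (modes (intSnd c) (intSnd d)) with hW
  have hVV : V * V ≤ V := wordSpan_mul_le (modes_mul_pow_mul_modes_mem
    (intFst_mul_pow_mul_intFst a a) (intFst_mul_pow_mul_intFst a b)
    (intFst_mul_pow_mul_intFst b a) (intFst_mul_pow_mul_intFst b b))
  have hWW : W * W ≤ W := wordSpan_mul_le (modes_mul_pow_mul_modes_mem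
    (intSnd_mul_pow_mul_intSnd c c) (intSnd_mul_pow_mul_intSnd c d)
    (intSnd_mul_pow_mul_intSnd d c) (intSnd_mul_pow_mul_intSnd d d))
  have hWV : W * V ≤ V * W := wordSpan_mul_comm commute_mulFst_mulSnd
    (commute_modes (commute_mulFst_intSnd c) (commute_mulFst_intSnd d))
    (commute_modes (commute_mulSnd_intFst a) (commute_mulSnd_intFst b))
    (fun s => commute_modes
      (commute_modes (commute_intFst_intSnd a c).symm (commute_intFst_intSnd b c).symm s).symm
      (commute_modes (commute_intFst_intSnd a d).symm (commute_intFst_intSnd b d).symm s).symm)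
  have : (V * W) * (V * W) ≤ V * W := calc
    (V * W) * (V * W) = V * (W * V) * W := by simp only [mul_assoc]
    _ ≤ V * (V * W) * W := by gcongr
    _ = (V * V) * (W * W) := by simp only [mul_assoc]
    _ ≤ V * W := by gcongr
  exact this (Submodule.mul_mem_mul hS hT)

/-! ### Evaluation at a point and the two one-sided integrals -/

/-- Evaluation at `x`, integration over `[a, x]`, and integration over `[x, b]`. -/
def partialIntegral {E : Type*} [NormedAddCommGroup E] [NormedSpace ℝ E] (a b : ℝ)
    (s : Fin 3) (x : ℝ) (f : ℝ → E) : E :=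
  ![f x, ∫ θ in a..x, f θ, ∫ θ in x..b, f θ] s

section PartialIntegral

variable {E : Type*} [NormedAddCommGroup E] [NormedSpace ℝ E] {a b x : ℝ} {s : Fin 3}

theorem partialIntegral_congr {f g : ℝ → E} (hx : x ∈ Icc a b)
    (h : ∀ θ ∈ Icc a b, (s = 0 → θ = x) → f θ = g θ) :
    partialIntegral a b s x f = partialIntegral a b s x g := by
  fin_cases s
  · exact h x hx fun _ => rfl
  · refine intervalIntegral.integral_congr fun θ hθ => h θ ?_ (by simp)
    rw [uIcc_of_le hx.1] at hθ
    exact ⟨hθ.1, hθ.2.trans hx.2⟩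
  · refine intervalIntegral.integral_congr fun θ hθ => h θ ?_ (by simp)
    rw [uIcc_of_le hx.2] at hθ
    exact ⟨hx.1.trans hθ.1, hθ.2⟩

theorem partialIntegral_add {f g : ℝ → E} (hf : Continuous f) (hg : Continuous g) :
    partialIntegral a b s x (fun θ => f θ + g θ) =
      partialIntegral a b s x f + partialIntegral a b s x g := by
  fin_cases s
  · rfl
  all_goals
    exact intervalIntegral.integral_add (hf.intervalIntegrable _ _) (hg.intervalIntegrable _ _)

theorem partialIntegral_finsetSum {ι : Type*} {S : Finset ι} {f : ι → ℝ → E}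
    (hf : ∀ i, Continuous (f i)) :
    partialIntegral a b s x (fun θ => ∑ i ∈ S, f i θ) =
      ∑ i ∈ S, partialIntegral a b s x (f i) := by
  fin_cases s
  · rfl
  all_goals
    exact intervalIntegral.integral_finsetSum fun i _ => (hf i).intervalIntegrable _ _

theorem partialIntegral_const_mul (r : ℝ) (f : ℝ → ℝ) :
    partialIntegral a b s x (fun θ => r * f θ) = r * partialIntegral a b s x f := by
  fin_cases s
  · rfl
  all_goals exact intervalIntegral.integral_const_mul _ _

theorem partialIntegral_apply {n : ℕ} {f : ℝ → Fin n → ℝ} (hf : Continuous f) (i : Fin n) :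
    partialIntegral a b s x f i = partialIntegral a b s x fun θ => f θ i := by
  fin_cases s
  · rfl
  all_goals
    exact (ContinuousLinearMap.intervalIntegral_comp_comm
      (ContinuousLinearMap.proj (R := ℝ) (φ := fun _ : Fin n => ℝ) i)
      (hf.intervalIntegrable _ _)).symm

theorem continuous_partialIntegral {Z : Type*} [TopologicalSpace Z] {F : Z → ℝ → E}
    (hF : Continuous (Function.uncurry F)) :
    Continuous fun z => partialIntegral a b s x (F z) := by
  fin_cases s
  · exact hF.comp (by fun_prop : Continuous fun z => (z, x))
  all_goals
    exact intervalIntegral.continuous_parametric_intervalIntegral_of_continuous' hF _ _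

end PartialIntegral

theorem modes_intFst_apply (a b : ℝ) (s : Fin 3) (u : C(ℝ × ℝ, ℝ)) (q : ℝ × ℝ) :
    modes (intFst a) (intFst b) s u q =
      partialIntegral a b s q.1 fun θ => u (θ, q.2) := by
  fin_cases s
  · rfl
  · rfl
  · exact (intervalIntegral.integral_symm _ _).symm

theorem modes_intSnd_apply (c d : ℝ) (t : Fin 3) (u : C(ℝ × ℝ, ℝ)) (q : ℝ × ℝ) :
    modes (intSnd c) (intSnd d) t u q =
      partialIntegral c d t q.2 fun ν => u (q.1, ν) := by
  fin_cases t
  · rfl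
  · rfl
  · exact (intervalIntegral.integral_symm _ _).symm

/-- The integral operator with polynomial kernel. -/
def kernelOp (a b c d : ℝ) (s t : Fin 3) : MvPolynomial (Fin 4) ℝ →ₗ[ℝ] PlaneOp :=
  (MvPolynomial.basisMonomials (Fin 4) ℝ).constr ℝ fun m =>
    (mulFst ^ m 0 * modes (intFst a) (intFst b) s * mulFst ^ m 2) *
      (mulSnd ^ m 1 * modes (intSnd c) (intSnd d) t * mulSnd ^ m 3)

theorem kernelOp_monomial (a b c d : ℝ) (s t : Fin 3) (m : Fin 4 →₀ ℕ) (r : ℝ) :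
    kernelOp a b c d s t (MvPolynomial.monomial m r) = r •
      ((mulFst ^ m 0 * modes (intFst a) (intFst b) s * mulFst ^ m 2) *
        (mulSnd ^ m 1 * modes (intSnd c) (intSnd d) t * mulSnd ^ m 3)) := by
  have h : MvPolynomial.monomial m r =
      r • MvPolynomial.basisMonomials (Fin 4) ℝ m := by
    simp [MvPolynomial.smul_monomial]
  rw [h, map_smul, kernelOp, Module.Basis.constr_basis]

theorem kernelOp_mem (a b c d : ℝ) (s t : Fin 3) (P : MvPolynomial (Fin 4) ℝ) :
    kernelOp a b c d s t P ∈ polyOps a b c d := by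
  induction P using MvPolynomial.induction_on' with
  | monomial m r =>
    rw [kernelOp_monomial]
    exact Submodule.smul_mem _ _ (Submodule.mul_mem_mul (word_mem _ _ _ _ _) (word_mem _ _ _ _ _))
  | add P Q hP hQ =>
    rw [map_add]
    exact add_mem hP hQ

theorem continuous_eval_mul (P : MvPolynomial (Fin 4) ℝ) (u : C(ℝ × ℝ, ℝ)) (x y : ℝ) :
    Continuous (Function.uncurry fun θ ν : ℝ =>
      MvPolynomial.eval ![x, y, θ, ν] P * u (θ, ν)) :=
  ((MvPolynomial.continuous_eval P).comp (by fun_prop :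
    Continuous fun q : ℝ × ℝ => ![x, y, q.1, q.2])).mul u.continuous

theorem kernelOp_apply (a b c d : ℝ) (s t : Fin 3) (P : MvPolynomial (Fin 4) ℝ)
    (u : C(ℝ × ℝ, ℝ)) (q : ℝ × ℝ) :
    kernelOp a b c d s t P u q =
      partialIntegral a b s q.1 fun θ => partialIntegral c d t q.2 fun ν =>
        MvPolynomial.eval ![q.1, q.2, θ, ν] P * u (θ, ν) := by
  induction P using MvPolynomial.induction_on' with
  | monomial m r =>
    have h : ∀ θ ν : ℝ, MvPolynomial.eval ![q.1, q.2, θ, ν] (MvPolynomial.monomial m r) *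
        u (θ, ν) = (r * q.1 ^ m 0) * (θ ^ m 2 * (q.2 ^ m 1 * (ν ^ m 3 * u (θ, ν)))) := by
      intro θ ν
      rw [MvPolynomial.eval_monomial, Finsupp.prod_fintype _ _ (by simp)]
      simp [Fin.prod_univ_four]
      ring
    simp only [h, partialIntegral_const_mul]
    simp only [kernelOp_monomial, LinearMap.smul_apply, ContinuousMap.smul_apply, smul_eq_mul,
      Module.End.mul_apply, mulFst_pow_apply, mulSnd_pow_apply, modes_intFst_apply,
      modes_intSnd_apply]
    ring
  | add P Q hP hQ =>
    have hc := fun R => continuous_eval_mul R u q.1 q.2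
    have h : ∀ θ, (partialIntegral c d t q.2 fun ν =>
        MvPolynomial.eval ![q.1, q.2, θ, ν] (P + Q) * u (θ, ν)) =
        (partialIntegral c d t q.2 fun ν => MvPolynomial.eval ![q.1, q.2, θ, ν] P * u (θ, ν)) +
        partialIntegral c d t q.2 fun ν => MvPolynomial.eval ![q.1, q.2, θ, ν] Q * u (θ, ν) := by
      intro θ
      rw [← partialIntegral_add ((hc P).uncurry_left θ) ((hc Q).uncurry_left θ)]
      simp only [map_add, add_mul]
    simp only [h]
    rw [partialIntegral_add (continuous_partialIntegral (hc P))
      (continuous_partialIntegral (hc Q)), ← hP, ← hQ, map_add]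
    rfl

theorem exists_kernelOp_of_mem_polyOps {a b c d : ℝ} {T : PlaneOp}
    (hT : T ∈ polyOps a b c d) :
    ∃ P : Fin 3 → Fin 3 → MvPolynomial (Fin 4) ℝ,
      T = ∑ s, ∑ t, kernelOp a b c d s t (P s t) := by
  rw [polyOps, wordSpan, wordSpan, Submodule.span_mul_span] at hT
  induction hT using Submodule.span_induction with
  | mem T h =>
    obtain ⟨_, ⟨⟨i, k, s⟩, rfl⟩, _, ⟨⟨j, l, t⟩, rfl⟩, rfl⟩ := h
    refine ⟨fun s' t' => if s' = s then if t' = t then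
      MvPolynomial.monomial (Finsupp.equivFunOnFinite.symm ![i, j, k, l]) 1 else 0 else 0, ?_⟩
    rw [Finset.sum_eq_single s, Finset.sum_eq_single t]
    · simp [kernelOp_monomial]
    · intro t' _ ht
      simp [ht]
    · simp
    · intro s' _ hs
      simp [hs]
    · simp
  | zero => exact ⟨0, by simp⟩
  | add S T _ _ hS hT =>
    obtain ⟨P, rfl⟩ := hS
    obtain ⟨Q, rfl⟩ := hT
    exact ⟨P + Q, by simp [Finset.sum_add_distrib]⟩
  | smul r T _ hT =>
    obtain ⟨P, rfl⟩ := hT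
    exact ⟨r • P, by simp [Finset.smul_sum]⟩

/-! ### Kernel families and their polynomial representations -/

/-- The nine kernels of a family, all viewed as functions of four variables. -/
def PI2DK.kernel {p r : ℕ} (N : PI2DK p r) (s t : Fin 3) (x y θ ν : ℝ) :
    Matrix (Fin p) (Fin r) ℝ :=
  ![![N.k00 x y, N.k01 x y ν, N.k02 x y ν],
    ![N.k10 x y θ, N.k11 x y θ ν, N.k12 x y θ ν],
    ![N.k20 x y θ, N.k21 x y θ ν, N.k22 x y θ ν]] s t

/-- The kernels of `N` coincide with the polynomials `P` on the relevant domains. -/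
def PI2DK.IsRep {p r : ℕ} (a b c d : ℝ) (N : PI2DK p r)
    (P : Fin p → Fin r → Fin 3 → Fin 3 → MvPolynomial (Fin 4) ℝ) : Prop :=
  ∀ i j s t, ∀ x ∈ Icc a b, ∀ y ∈ Icc c d, ∀ θ ∈ Icc a b, ∀ ν ∈ Icc c d,
    (s = 0 → θ = x) → (t = 0 → ν = y) →
      N.kernel s t x y θ ν i j = MvPolynomial.eval ![x, y, θ, ν] (P i j s t)

theorem PI2D_eq_sum {p r : ℕ} (a b c d : ℝ) (N : PI2DK p r) (w : ℝ → ℝ → Fin r → ℝ)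
    (x y : ℝ) :
    PI2D a b c d N w x y = ∑ s, ∑ t, partialIntegral a b s x fun θ =>
      partialIntegral c d t y fun ν => N.kernel s t x y θ ν *ᵥ w θ ν := by
  simp only [Fin.sum_univ_three, PI2D, partialIntegral, PI2DK.kernel, Matrix.cons_val]
  abel

theorem PI2DK.IsRep.PI2D_apply {p r : ℕ} {a b c d : ℝ} {N : PI2DK p r}
    {P : Fin p → Fin r → Fin 3 → Fin 3 → MvPolynomial (Fin 4) ℝ} (h : N.IsRep a b c d P)
    {w : ℝ → ℝ → Fin r → ℝ} {v : Fin r → C(ℝ × ℝ, ℝ)}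
    (hw : ∀ x ∈ Icc a b, ∀ y ∈ Icc c d, ∀ j, w x y j = v j (x, y))
    {x y : ℝ} (hx : x ∈ Icc a b) (hy : y ∈ Icc c d) (i : Fin p) :
    PI2D a b c d N w x y i =
      ∑ j, (∑ s, ∑ t, kernelOp a b c d s t (P i j s t)) (v j) (x, y) := by
  have key : ∀ s t, (partialIntegral a b s x fun θ =>
      partialIntegral c d t y fun ν => N.kernel s t x y θ ν *ᵥ w θ ν) i =
      ∑ j, kernelOp a b c d s t (P i j s t) (v j) (x, y) := by
    intro s t
    have hc := fun i j => continuous_eval_mul (P i j s t) (v j) x y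
    have hF : Continuous (Function.uncurry fun θ ν : ℝ => fun i =>
        ∑ j, MvPolynomial.eval ![x, y, θ, ν] (P i j s t) * v j (θ, ν)) :=
      continuous_pi fun i => continuous_finsetSum _ fun j _ => hc i j
    have h1 : (partialIntegral a b s x fun θ =>
        partialIntegral c d t y fun ν => N.kernel s t x y θ ν *ᵥ w θ ν) =
        partialIntegral a b s x fun θ => partialIntegral c d t y fun ν => fun i =>
          ∑ j, MvPolynomial.eval ![x, y, θ, ν] (P i j s t) * v j (θ, ν) := by
      refine partialIntegral_congr hx fun θ hθ hs => partialIntegral_congr hy fun ν hν ht => ?_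
      ext i
      simp only [Matrix.mulVec, dotProduct]
      refine Finset.sum_congr rfl fun j _ => ?_
      rw [h i j s t x hx y hy θ hθ ν hν hs ht, hw θ hθ ν hν]
    rw [h1, partialIntegral_apply (continuous_partialIntegral hF)]
    simp only [kernelOp_apply]
    rw [← partialIntegral_finsetSum fun j => continuous_partialIntegral (hc i j)]
    congr 1
    ext θ
    rw [partialIntegral_apply (hF.uncurry_left θ),
      ← partialIntegral_finsetSum fun j => (hc i j).uncurry_left θ]
  simp only [PI2D_eq_sum, Finset.sum_apply, key, LinearMap.sum_apply, ContinuousMap.sum_apply]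
  exact Finset.sum_comm_cycle

theorem PI2DK.IsPoly.exists_isRep {p r : ℕ} {a b c d : ℝ} {N : PI2DK p r}
    (h : N.IsPoly a b c d) : ∃ P, N.IsRep a b c d P := by
  obtain ⟨h00, h10, h20, h01, h02, h11, h21, h12, h22⟩ := h
  have H : ∀ i j s t, ∃ P : MvPolynomial (Fin 4) ℝ,
      ∀ x ∈ Icc a b, ∀ y ∈ Icc c d, ∀ θ ∈ Icc a b, ∀ ν ∈ Icc c d,
        N.kernel s t x y θ ν i j = MvPolynomial.eval ![x, y, θ, ν] P := by
    intro i j s t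
    have hθ : ∀ f, PolyOn3 (Icc a b) (Icc c d) (Icc a b) f → ∃ P : MvPolynomial (Fin 4) ℝ,
        ∀ x ∈ Icc a b, ∀ y ∈ Icc c d, ∀ θ ∈ Icc a b, ∀ ν ∈ Icc c d,
          f x y θ = MvPolynomial.eval ![x, y, θ, ν] P := by
      rintro f ⟨P, hP⟩
      refine ⟨MvPolynomial.rename ![0, 1, 2] P, fun x hx y hy θ hθ ν hν => ?_⟩
      rw [MvPolynomial.eval_rename, hP x hx y hy θ hθ]
      congr 2
      ext k
      fin_cases k <;> rfl
    have hν : ∀ f, PolyOn3 (Icc a b) (Icc c d) (Icc c d) f → ∃ P : MvPolynomial (Fin 4) ℝ,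
        ∀ x ∈ Icc a b, ∀ y ∈ Icc c d, ∀ θ ∈ Icc a b, ∀ ν ∈ Icc c d,
          f x y ν = MvPolynomial.eval ![x, y, θ, ν] P := by
      rintro f ⟨P, hP⟩
      refine ⟨MvPolynomial.rename ![0, 1, 3] P, fun x hx y hy θ hθ ν hν => ?_⟩
      rw [MvPolynomial.eval_rename, hP x hx y hy ν hν]
      congr 2
      ext k
      fin_cases k <;> rfl
    fin_cases s <;> fin_cases t
    · obtain ⟨P, hP⟩ := h00 i j
      refine ⟨MvPolynomial.rename ![0, 1] P, fun x hx y hy θ hθ ν hν => ?_⟩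
      rw [MvPolynomial.eval_rename]
      refine (hP x hx y hy).trans ?_
      congr 2
      ext k
      fin_cases k <;> rfl
    · exact hν _ (h01 i j)
    · exact hν _ (h02 i j)
    · exact hθ _ (h10 i j)
    · exact h11 i j
    · exact h12 i j
    · exact hθ _ (h20 i j)
    · exact h21 i j
    · exact h22 i j
  choose P hP using H
  exact ⟨P, fun i j s t x hx y hy θ hθ ν hν _ _ => hP i j s t x hx y hy θ hθ ν hν⟩

/-- The family of kernels given by polynomials in four variables. -/
def polyKernels {p r : ℕ} (P : Fin p → Fin r → Fin 3 → Fin 3 → MvPolynomial (Fin 4) ℝ) :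
    PI2DK p r where
  k00 x y := Matrix.of fun i j => MvPolynomial.eval ![x, y, x, y] (P i j 0 0)
  k10 x y θ := Matrix.of fun i j => MvPolynomial.eval ![x, y, θ, y] (P i j 1 0)
  k20 x y θ := Matrix.of fun i j => MvPolynomial.eval ![x, y, θ, y] (P i j 2 0)
  k01 x y ν := Matrix.of fun i j => MvPolynomial.eval ![x, y, x, ν] (P i j 0 1)
  k02 x y ν := Matrix.of fun i j => MvPolynomial.eval ![x, y, x, ν] (P i j 0 2)
  k11 x y θ ν := Matrix.of fun i j => MvPolynomial.eval ![x, y, θ, ν] (P i j 1 1)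
  k21 x y θ ν := Matrix.of fun i j => MvPolynomial.eval ![x, y, θ, ν] (P i j 2 1)
  k12 x y θ ν := Matrix.of fun i j => MvPolynomial.eval ![x, y, θ, ν] (P i j 1 2)
  k22 x y θ ν := Matrix.of fun i j => MvPolynomial.eval ![x, y, θ, ν] (P i j 2 2)

section PolyKernels

variable {p r : ℕ} (P : Fin p → Fin r → Fin 3 → Fin 3 → MvPolynomial (Fin 4) ℝ)
  (a b c d : ℝ)

theorem isRep_polyKernels : (polyKernels P).IsRep a b c d P := by
  intro i j s t x _ y _ θ _ ν _ hs ht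
  fin_cases s <;> fin_cases t
  · obtain rfl := hs rfl
    obtain rfl := ht rfl
    rfl
  · obtain rfl := hs rfl
    rfl
  · obtain rfl := hs rfl
    rfl
  · obtain rfl := ht rfl
    rfl
  · rfl
  · rfl
  · obtain rfl := ht rfl
    rfl
  · rfl
  · rfl

theorem isCont_polyKernels : (polyKernels P).IsCont a b c d := by
  have h : ∀ {Z : Type} [TopologicalSpace Z] (s t : Fin 3) {f : Z → Fin 4 → ℝ} (S : Set Z),
      Continuous f → ContinuousOn
        (fun z => Matrix.of fun i j => MvPolynomial.eval (f z) (P i j s t)) S :=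
    fun s t f S hf => (continuous_matrix fun i j =>
      (MvPolynomial.continuous_eval (P i j s t)).comp hf).continuousOn
  refine ⟨?_, ?_, ?_, ?_, ?_, ?_, ?_, ?_, ?_⟩ <;> exact h _ _ _ (by fun_prop)

theorem isPoly_polyKernels : (polyKernels P).IsPoly a b c d := by
  refine ⟨fun i j => ⟨MvPolynomial.rename ![0, 1, 0, 1] (P i j 0 0), ?_⟩,
    fun i j => ⟨MvPolynomial.rename ![0, 1, 2, 1] (P i j 1 0), ?_⟩,
    fun i j => ⟨MvPolynomial.rename ![0, 1, 2, 1] (P i j 2 0), ?_⟩,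
    fun i j => ⟨MvPolynomial.rename ![0, 1, 0, 2] (P i j 0 1), ?_⟩,
    fun i j => ⟨MvPolynomial.rename ![0, 1, 0, 2] (P i j 0 2), ?_⟩,
    fun i j => ⟨P i j 1 1, fun _ _ _ _ _ _ _ _ => rfl⟩,
    fun i j => ⟨P i j 2 1, fun _ _ _ _ _ _ _ _ => rfl⟩,
    fun i j => ⟨P i j 1 2, fun _ _ _ _ _ _ _ _ => rfl⟩,
    fun i j => ⟨P i j 2 2, fun _ _ _ _ _ _ _ _ => rfl⟩⟩
  all_goals
    intros
    rw [MvPolynomial.eval_rename]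
    change MvPolynomial.eval _ _ = _
    congr 2
    ext k
    fin_cases k <;> rfl

end PolyKernels

theorem exists_continuousMap_eqOn {m : ℕ} {a b c d : ℝ} (hab : a ≤ b) (hcd : c ≤ d)
    {u : ℝ → ℝ → Fin m → ℝ}
    (hu : ContinuousOn (fun q : ℝ × ℝ => u q.1 q.2) (Icc a b ×ˢ Icc c d)) :
    ∃ v : Fin m → C(ℝ × ℝ, ℝ), ∀ x ∈ Icc a b, ∀ y ∈ Icc c d, ∀ j, u x y j = v j (x, y) := by
  have hp : Continuous fun q : ℝ × ℝ =>
      ((projIcc a b hab q.1 : ℝ), (projIcc c d hcd q.2 : ℝ)) :=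
    ((continuous_subtype_val.comp continuous_projIcc).comp continuous_fst).prodMk
      ((continuous_subtype_val.comp continuous_projIcc).comp continuous_snd)
  have h := hu.comp_continuous hp fun q => ⟨Subtype.property _, Subtype.property _⟩
  refine ⟨fun j => ⟨_, (continuous_apply j).comp h⟩, fun x hx y hy j => ?_⟩
  simp [projIcc_of_mem hab hx, projIcc_of_mem hcd hy]

theorem sum_apply_sum_apply {p m : ℕ} (A : Fin p → PlaneOp) (B : Fin p → Fin m → PlaneOp)
    (v : Fin m → C(ℝ × ℝ, ℝ)) (q : ℝ × ℝ) :
    ∑ k, A k (∑ j, B k j (v j)) q = ∑ j, (∑ k, A k * B k j) (v j) q := by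
  simp only [map_sum, LinearMap.sum_apply, ContinuousMap.sum_apply, Module.End.mul_apply]
  exact Finset.sum_comm

/-- Composition of 2D-PI operators with polynomial kernels is a 2D-PI
operator with polynomial kernels. -/
theorem composition_of_polynomial_2D_PI_operators {n p m : ℕ} (a b c d : ℝ)
    (hab : a < b) (hcd : c < d)
    (N : PI2DK n p) (M : PI2DK p m)
    (hN : N.IsCont a b c d) (hM : M.IsCont a b c d)
    (hNp : N.IsPoly a b c d) (hMp : M.IsPoly a b c d) :
    ∃ Q : PI2DK n m, Q.IsCont a b c d ∧ Q.IsPoly a b c d ∧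
      ∀ u : ℝ → ℝ → Fin m → ℝ,
        ContinuousOn (fun q : ℝ × ℝ => u q.1 q.2) (Icc a b ×ˢ Icc c d) →
        ∀ x ∈ Icc a b, ∀ y ∈ Icc c d,
          PI2D a b c d N (PI2D a b c d M u) x y = PI2D a b c d Q u x y := by
  obtain ⟨PN, hPN⟩ := hNp.exists_isRep
  obtain ⟨PM, hPM⟩ := hMp.exists_isRep
  have hmem : ∀ P : Fin 3 → Fin 3 → MvPolynomial (Fin 4) ℝ,
      ∑ s, ∑ t, kernelOp a b c d s t (P s t) ∈ polyOps a b c d := fun P =>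
    sum_mem fun s _ => sum_mem fun t _ => kernelOp_mem a b c d s t (P s t)
  have hex : ∀ i j, ∃ P : Fin 3 → Fin 3 → MvPolynomial (Fin 4) ℝ,
      ∑ k, (∑ s, ∑ t, kernelOp a b c d s t (PN i k s t)) *
        (∑ s, ∑ t, kernelOp a b c d s t (PM k j s t)) =
      ∑ s, ∑ t, kernelOp a b c d s t (P s t) := fun i j =>
    exists_kernelOp_of_mem_polyOps
      (sum_mem fun k _ => mul_mem_polyOps (hmem (PN i k)) (hmem (PM k j)))
  choose PQ hPQ using hex
  refine ⟨polyKernels PQ, isCont_polyKernels PQ a b c d, isPoly_polyKernels PQ a b c d,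
    fun u hu x hx y hy => ?_⟩
  obtain ⟨v, hv⟩ := exists_continuousMap_eqOn hab.le hcd.le hu
  have hMu : ∀ x ∈ Icc a b, ∀ y ∈ Icc c d, ∀ k, PI2D a b c d M u x y k =
      (∑ j, (∑ s, ∑ t, kernelOp a b c d s t (PM k j s t)) (v j)) (x, y) := by
    intro x hx y hy k
    rw [hPM.PI2D_apply hv hx hy, ContinuousMap.sum_apply]
  ext i
  rw [hPN.PI2D_apply hMu hx hy, (isRep_polyKernels PQ a b c d).PI2D_apply hv hx hy]
  simp only [← hPQ]
  exact sum_apply_sum_apply (fun k => ∑ s, ∑ t, kernelOp a b c d s t (PN i k s t))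
    (fun k j => ∑ s, ∑ t, kernelOp a b c d s t (PM k j s t)) v (x, y)
end
end
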